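/- arXiv:2602.15542 — 4 statements merged into one kernel-verified Lean document; each statement's English description precedes it below -/
import Mathlib

section
/- Let Q = G ∪ I be a countable linearly ordered set with G and I disjoint, such that G interlaces I (between any two elements of I there is an element of G) and both the least and greatest elements of Q exist and belong to G. Then there exists a compact set Y ⊆ ℝ and an order isomorphism F from Q to the ordered family Q_Y of Y-gaps and Y-intervals such that F maps G onto the set of Y-gaps and I onto the set of Y-intervals. -/
open Set

def gapsOf (Y : Set ℝ) : Set (Set ℝ) :=
  {S | ∃ x ∉ Y, S = connectedComponentIn Yᶜ x}

def intervalsOf (Y : Set ℝ) : Set (Set ℝ) :=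
  {S | (∃ x ∈ Y, S = connectedComponentIn Y x) ∧ S.Nontrivial}

def QOf (Y : Set ℝ) : Set (Set ℝ) := gapsOf Y ∪ intervalsOf Y

def setLT (I J : Set ℝ) : Prop := ∀ x ∈ I, ∀ y ∈ J, x < y

def Interlaces (G B : Set (Set ℝ)) : Prop :=
  ∀ I ∈ B, ∀ J ∈ B, setLT I J → ∃ K ∈ G, setLT I K ∧ setLT K J

def IsTame (A : Set ℝ) : Prop :=
  ∀ Y : Set ℝ, Nonempty (↥A ≃ₜ ↥Y) → ∃ f : ℝ ≃ₜ ℝ, f '' A = Y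

def RegularlyClosedIn (X : Set ℝ) : Prop :=
  IsClosed X ∧ X ⊆ closure (⋃₀ intervalsOf X)

def trivCompOf (X : Set ℝ) : Set ℝ := {x ∈ X | connectedComponentIn X x = {x}}

def BOf (X : Set ℝ) : Set (Set ℝ) :=
  {I ∈ intervalsOf X | ∀ e, (IsLeast I e ∨ IsGreatest I e) → e ∈ closure (X \ I)}

def MCantorval (X : Set ℝ) : Prop :=
  X.Nonempty ∧ Bornology.IsBounded X ∧ RegularlyClosedIn X ∧
  ∀ I ∈ intervalsOf X, ∀ e, (IsLeast I e ∨ IsGreatest I e) →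
    e ∈ closure (trivCompOf X \ {e})

/-- A countable linear order can be laid out as a family of consecutive nondegenerate intervals
of the line that leaves no gap of positive length. -/
theorem exists_dense_interval_layout (Q : Type*) [LinearOrder Q] [Countable Q] :
    ∃ l r : Q → ℝ, (∀ q, l q < r q) ∧ (∀ p q, p < q → r p ≤ l q) ∧
      ∀ x y, x < y → (∃ p, l p ≤ x) → (∃ p, y ≤ r p) → ∃ q, l q < y ∧ x < r q := by
  classical
  have := Encodable.ofCountable Q
  obtain ⟨w, hw, c, hc, -⟩ := posSumOfEncodable (ε := 1) one_pos Q
  have hs : Summable w := hc.summable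
  have hind : ∀ A : Set Q, Summable (A.indicator w) := fun A => hs.indicator A
  have hnn : ∀ q, 0 ≤ w q := fun q => (hw q).le
  have hfin : ∀ (s : Finset Q) (A : Set Q), (∀ q ∈ s, q ∈ A) →
      ∑ q ∈ s, w q ≤ ∑' q, A.indicator w q := by
    intro s A hA
    calc ∑ q ∈ s, w q = ∑ q ∈ s, A.indicator w q :=
          Finset.sum_congr rfl fun q hq => (indicator_of_mem (hA q hq) w).symm
      _ ≤ _ := (hind A).sum_le_tsum s fun q _ => indicator_nonneg (fun q _ => hnn q) q
  have hmono : ∀ A B : Set Q, A ⊆ B → ∑' q, A.indicator w q ≤ ∑' q, B.indicator w q :=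
    fun A B h => (hind A).tsum_le_tsum
      (indicator_le_indicator_of_subset h hnn) (hind B)
  have hadd : ∀ A : Set Q, ∑' q, A.indicator w q + ∑' q, Aᶜ.indicator w q = ∑' q, w q := by
    intro A
    rw [← (hind A).tsum_add (hind Aᶜ)]
    exact tsum_congr fun q => congrFun (indicator_self_add_compl A w) q
  refine ⟨fun q => ∑' p, (Iio q).indicator w p, fun q => ∑' p, (Iic q).indicator w p,
    fun q => ?_, fun p q hpq => hmono _ _ (Iic_subset_Iio.2 hpq), ?_⟩
  · refine (hind _).tsum_lt_tsum (i := q)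
      (indicator_le_indicator_of_subset Iio_subset_Iic_self hnn) ?_ (hind _)
    simpa using hw q
  · rintro x y hxy ⟨p₀, hp₀⟩ ⟨p₁, hp₁⟩
    by_contra! hcon
    have hx : 0 ≤ x := le_trans (tsum_nonneg fun q => indicator_nonneg (fun q _ => hnn q) q) hp₀
    have hy : y ≤ ∑' q, w q := by
      refine hp₁.trans ((hmono _ univ (subset_univ _)).trans ?_)
      simp
    have hle : ∑' q, w q ≤ x + (∑' q, w q - y) := by
      refine hs.tsum_le_of_sum_le fun s => ?_
      rw [← Finset.sum_filter_add_sum_filter_not s (fun q => ∑' p, (Iio q).indicator w p < y)]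
      refine add_le_add ?_ ?_
      · rcases (s.filter fun q => ∑' p, (Iio q).indicator w p < y).eq_empty_or_nonempty with h | h
        · simpa [h] using hx
        · refine (hfin _ (Iic (Finset.max' _ h)) fun q hq => Finset.le_max' _ q hq).trans ?_
          exact hcon _ (Finset.mem_filter.1 (Finset.max'_mem _ h)).2
      · rcases (s.filter fun q => ¬ ∑' p, (Iio q).indicator w p < y).eq_empty_or_nonempty
          with h | h
        · rw [h, Finset.sum_empty]; linarith
        · have h1 := hfin _ (Iio (Finset.min' _ h))ᶜ fun q hq =>
            not_lt.2 (Finset.min'_le _ q hq)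
          have h2 := (Finset.mem_filter.1 (Finset.min'_mem _ h)).2
          have h3 := hadd (Iio (Finset.min' _ h))
          linarith
    linarith

/-- In a disjoint family of open preconnected sets, each member is a connected component of the
union. -/
theorem connectedComponentIn_biUnion_eq {ι X : Type*} [TopologicalSpace X] {G : Set ι}
    {F : ι → Set X} (hopen : ∀ i ∈ G, IsOpen (F i)) (hconn : ∀ i ∈ G, IsPreconnected (F i))
    (hdisj : G.PairwiseDisjoint F) {i : ι} (hi : i ∈ G) {x : X} (hx : x ∈ F i) :
    connectedComponentIn (⋃ j ∈ G, F j) x = F i := by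
  have hxU : x ∈ ⋃ j ∈ G, F j := mem_biUnion hi hx
  refine Subset.antisymm ?_ ((hconn i hi).subset_connectedComponentIn hx
    (subset_biUnion_of_mem (u := F) hi))
  refine isPreconnected_connectedComponentIn.subset_left_of_subset_union (hopen i hi)
    (v := ⋃ j ∈ G \ {i}, F j) (isOpen_biUnion fun j hj => hopen j hj.1) ?_ ?_
    ⟨x, mem_connectedComponentIn hxU, hx⟩
  · exact disjoint_iUnion₂_right.2 fun j hj => hdisj hi hj.1 (Ne.symm hj.2)
  · intro y hy
    obtain ⟨j, hj, hyj⟩ := mem_iUnion₂.1 (connectedComponentIn_subset _ _ hy)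
    by_cases hji : j = i
    · exact Or.inl (hji ▸ hyj)
    · exact Or.inr (mem_biUnion (show j ∈ G \ {i} from ⟨hj, hji⟩) hyj)

theorem reverse_reduction {Q : Type*} [LinearOrder Q] [Countable Q]
    (G I : Set Q) (hdisj : Disjoint G I) (hcover : G ∪ I = Set.univ)
    (hinter : ∀ a ∈ I, ∀ b ∈ I, a < b → ∃ k ∈ G, a < k ∧ k < b)
    (hmin : ∃ m, IsLeast Set.univ m ∧ m ∈ G)
    (hmax : ∃ m, IsGreatest Set.univ m ∧ m ∈ G) :
    ∃ (Y : Set ℝ) (F : Q → Set ℝ), IsCompact Y ∧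
      Function.Injective F ∧ Set.range F = QOf Y ∧
      (∀ a b : Q, a < b ↔ setLT (F a) (F b)) ∧
      F '' G = gapsOf Y ∧ F '' I = intervalsOf Y := by
  classical
  obtain ⟨m, ⟨-, hm⟩, hmG⟩ := hmin
  obtain ⟨M, ⟨-, hM⟩, hMG⟩ := hmax
  replace hm : ∀ q, m ≤ q := fun q => hm (mem_univ q)
  replace hM : ∀ q, q ≤ M := fun q => hM (mem_univ q)
  obtain ⟨l, r, hlr, hrl, hdense⟩ := exists_dense_interval_layout Q
  have hGI : ∀ q, q ∉ G → q ∈ I := fun q hq =>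
    ((hcover ▸ mem_univ q : q ∈ G ∪ I)).resolve_left hq
  have hIG : ∀ q, q ∈ I → q ∉ G := fun q hq hq' => disjoint_left.1 hdisj hq' hq
  let F : Q → Set ℝ := fun q =>
    if q ∈ G then {x | (q = m ∨ l q < x) ∧ (q = M ∨ x < r q)} else Icc (l q) (r q)
  have hFG : ∀ q ∈ G, F q = {x | (q = m ∨ l q < x) ∧ (q = M ∨ x < r q)} :=
    fun q hq => if_pos hq
  have hFI : ∀ q ∈ I, F q = Icc (l q) (r q) := fun q hq => if_neg (hIG q hq)
  have hIoo : ∀ q, Ioo (l q) (r q) ⊆ F q := by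
    intro q x hx
    by_cases hq : q ∈ G
    · rw [hFG q hq]; exact ⟨Or.inr hx.1, Or.inr hx.2⟩
    · rw [hFI q (hGI q hq)]; exact Ioo_subset_Icc_self hx
  have hnt : ∀ q, (F q).Nontrivial := fun q => by
    obtain ⟨a, ha, hb⟩ := exists_between (hlr q)
    obtain ⟨b, hab, hb'⟩ := exists_between hb
    exact ⟨a, hIoo q ⟨ha, hb⟩, b, hIoo q ⟨ha.trans hab, hb'⟩, hab.ne⟩
  have hconn : ∀ q, IsPreconnected (F q) := by
    intro q
    rw [isPreconnected_iff_ordConnected]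
    by_cases hq : q ∈ G
    · rw [hFG q hq]
      exact ⟨fun x hx y hy z hz => ⟨hx.1.imp_right fun h => h.trans_le hz.1,
        hy.2.imp_right fun h => hz.2.trans_lt h⟩⟩
    · rw [hFI q (hGI q hq)]; exact ordConnected_Icc
  have hopen : ∀ q ∈ G, IsOpen (F q) := by
    intro q hq
    rw [hFG q hq]
    exact (isOpen_const.union isOpen_Ioi).inter (isOpen_const.union isOpen_Iio)
  have hupper : ∀ p q, p < q → ∀ x ∈ F p, x ≤ r p ∧ (p ∈ G → x < r p) := by
    intro p q hpq x hx
    by_cases hp : p ∈ G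
    · rw [hFG p hp] at hx
      have := hx.2.resolve_left (fun h => (hpq.trans_le (hM q)).ne h)
      exact ⟨this.le, fun _ => this⟩
    · rw [hFI p (hGI p hp)] at hx
      exact ⟨hx.2, fun h => absurd h hp⟩
  have hlower : ∀ p q, p < q → ∀ y ∈ F q, l q ≤ y ∧ (q ∈ G → l q < y) := by
    intro p q hpq y hy
    by_cases hq : q ∈ G
    · rw [hFG q hq] at hy
      have := hy.1.resolve_left (fun h => ((hm p).trans_lt hpq).ne h.symm)
      exact ⟨this.le, fun _ => this⟩
    · rw [hFI q (hGI q hq)] at hy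
      exact ⟨hy.1, fun h => absurd h hq⟩
  have hlt : ∀ p q, p < q → setLT (F p) (F q) := by
    intro p q hpq x hx y hy
    obtain ⟨hx1, hx2⟩ := hupper p q hpq x hx
    obtain ⟨hy1, hy2⟩ := hlower p q hpq y hy
    have h := hrl p q hpq
    by_cases hp : p ∈ G
    · linarith [hx2 hp]
    by_cases hq : q ∈ G
    · linarith [hy2 hq]
    obtain ⟨k, -, hpk, hkq⟩ := hinter p (hGI p hp) q (hGI q hq) hpq
    linarith [hrl p k hpk, hrl k q hkq, hlr k]
  have hiff : ∀ a b : Q, a < b ↔ setLT (F a) (F b) := by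
    refine fun a b => ⟨hlt a b, fun h => ?_⟩
    obtain ⟨x, hx⟩ := (hnt a).nonempty
    obtain ⟨y, hy⟩ := (hnt b).nonempty
    rcases lt_trichotomy a b with hab | rfl | hab
    · exact hab
    · exact absurd (h x hx x hx) (lt_irrefl x)
    · exact absurd (h x hx y hy) (hlt b a hab y hy x hx).asymm
  have heq : ∀ p q x, x ∈ F p → x ∈ F q → p = q := by
    intro p q x hp hq
    rcases lt_trichotomy p q with h | h | h
    · exact absurd (hlt p q h x hp x hq) (lt_irrefl x)
    · exact h
    · exact absurd (hlt q p h x hq x hp) (lt_irrefl x)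
  let U : Set ℝ := ⋃ q ∈ G, F q
  have hFY : ∀ q ∈ I, F q ⊆ Uᶜ := by
    intro q hq x hx hxU
    obtain ⟨k, hk, hxk⟩ := mem_iUnion₂.1 hxU
    exact hIG q hq (heq k q x hxk hx ▸ hk)
  have hYI : ∀ q x, x ∈ Uᶜ → x ∈ F q → q ∈ I := fun q x hx hxq =>
    hGI q fun hq => hx (mem_biUnion hq hxq)
  have hYsub : Uᶜ ⊆ Icc (l m) (r M) := by
    intro x hx
    constructor
    · by_contra! h
      refine hx (mem_biUnion hmG ?_)
      rw [hFG m hmG]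
      exact ⟨Or.inl rfl, Or.inr (h.trans (hlr m))⟩
    · by_contra! h
      refine hx (mem_biUnion hMG ?_)
      rw [hFG M hMG]
      exact ⟨Or.inr ((hlr M).trans h), Or.inl rfl⟩
  have hhit : ∀ C ⊆ Uᶜ, ∀ u ∈ C, ∀ v, u < v → (∃ p, v ≤ r p) →
      Icc u v ⊆ C → ∃ q ∈ I, ∃ z ∈ Ioo u v, z ∈ C ∧ z ∈ Ioo (l q) (r q) := by
    intro C hC u hu v huv hv huvC
    obtain ⟨q, h1, h2⟩ := hdense u v huv ⟨m, (hYsub (hC hu)).1⟩ hv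
    obtain ⟨z, hz1, hz2⟩ := exists_between
      (show max (l q) u < min (r q) v from max_lt (lt_min (hlr q) h1) (lt_min h2 huv))
    rw [max_lt_iff] at hz1
    rw [lt_min_iff] at hz2
    have hzC : z ∈ C := huvC ⟨hz1.2.le, hz2.2.le⟩
    exact ⟨q, hYI q z (hC hzC) (hIoo q ⟨hz1.1, hz2.1⟩), z, ⟨hz1.2, hz2.2⟩, hzC, hz1.1, hz2.1⟩
  have hnotlt : ∀ C ⊆ Uᶜ, IsPreconnected C → ∀ p ∈ I, ∀ q ∈ I, ∀ x ∈ C, ∀ y ∈ C,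
      x ∈ F p → y ∈ F q → ¬ p < q := by
    intro C hC hCc p hp q hq x hx y hy hxp hyq hpq
    obtain ⟨k, hk, hpk, hkq⟩ := hinter p hp q hq hpq
    obtain ⟨z, hz⟩ := (hnt k).nonempty
    exact hC (hCc.ordConnected.out hx hy
      ⟨(hlt p k hpk x hxp z hz).le, (hlt k q hkq z hz y hyq).le⟩) (mem_biUnion hk hz)
  have hkey : ∀ C ⊆ Uᶜ, IsPreconnected C → C.Nontrivial → ∃ q ∈ I, C ⊆ F q := by
    intro C hC hCc hCn
    have hoc := hCc.ordConnected
    obtain ⟨u, hu, v, hv, huv⟩ := hCn.exists_lt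
    obtain ⟨q, hq, z, -, hzC, hzq⟩ :=
      hhit C hC u hu v huv ⟨M, (hYsub (hC hv)).2⟩ (hoc.out hu hv)
    refine ⟨q, hq, fun c hc => ?_⟩
    rw [hFI q hq]
    have huniq : ∀ p ∈ I, ∀ z' ∈ C, z' ∈ Ioo (l p) (r p) → p = q := fun p hp z' hz' hzp =>
      le_antisymm
        (not_lt.1 (hnotlt C hC hCc q hq p hp z hzC z' hz' (hIoo q hzq) (hIoo p hzp)))
        (not_lt.1 (hnotlt C hC hCc p hp q hq z' hz' z hzC (hIoo p hzp) (hIoo q hzq)))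
    constructor
    · by_contra! h
      obtain ⟨p, hp, z', hz', hz'C, hz'p⟩ := hhit C hC c hc (l q) h ⟨q, (hlr q).le⟩
        ((Icc_subset_Icc_right hzq.1.le).trans (hoc.out hc hzC))
      obtain rfl := huniq p hp z' hz'C hz'p
      exact hz'.2.asymm hz'p.1
    · by_contra! h
      have hsub := hoc.out hzC hc
      obtain ⟨p, hp, z', hz', hz'C, hz'p⟩ := hhit C hC (r q) (hsub ⟨hzq.2.le, h.le⟩) c h
        ⟨M, (hYsub (hC hc)).2⟩ ((Icc_subset_Icc_left hzq.2.le).trans hsub)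
      obtain rfl := huniq p hp z' hz'C hz'p
      exact hz'.1.asymm hz'p.2
  have hgap : ∀ q ∈ G, ∀ x ∈ F q, connectedComponentIn U x = F q := fun q hq x hx =>
    connectedComponentIn_biUnion_eq hopen (fun i _ => hconn i)
      (fun i _ j _ hij => disjoint_left.2 fun y hyi hyj => hij (heq i j y hyi hyj)) hq hx
  have hgaps : F '' G = gapsOf Uᶜ := by
    ext S
    constructor
    · rintro ⟨q, hq, rfl⟩
      obtain ⟨x, hx⟩ := (hnt q).nonempty
      refine ⟨x, fun h => h (mem_biUnion hq hx), ?_⟩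
      rw [compl_compl, hgap q hq x hx]
    · rintro ⟨x, hx, rfl⟩
      obtain ⟨q, hq, hxq⟩ := mem_iUnion₂.1 (not_notMem.1 hx)
      exact ⟨q, hq, by rw [compl_compl, hgap q hq x hxq]⟩
  have hints : F '' I = intervalsOf Uᶜ := by
    ext S
    constructor
    · rintro ⟨q, hq, rfl⟩
      obtain ⟨x, hx⟩ := (hnt q).nonempty
      refine ⟨⟨x, hFY q hq hx, ?_⟩, hnt q⟩
      have hsub := (hconn q).subset_connectedComponentIn hx (hFY q hq)
      obtain ⟨p, -, hCp⟩ := hkey _ (connectedComponentIn_subset _ _)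
        isPreconnected_connectedComponentIn ((hnt q).mono hsub)
      obtain rfl := heq p q x (hCp (hsub hx)) hx
      exact hsub.antisymm hCp
    · rintro ⟨⟨x, hx, rfl⟩, hn⟩
      obtain ⟨q, hq, hCq⟩ := hkey _ (connectedComponentIn_subset _ _)
        isPreconnected_connectedComponentIn hn
      exact ⟨q, hq, ((hconn q).subset_connectedComponentIn
        (hCq (mem_connectedComponentIn hx)) (hFY q hq)).antisymm hCq⟩
  refine ⟨Uᶜ, F, isCompact_Icc.of_isClosed_subset (isOpen_biUnion hopen).isClosed_compl hYsub,
    fun a b hab => ?_, ?_, hiff, hgaps, hints⟩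
  · obtain ⟨x, hx⟩ := (hnt a).nonempty
    exact heq a b x hx (hab ▸ hx)
  · rw [QOf, ← hgaps, ← hints, ← image_union, hcover, image_univ]
end

section
/- If a compact set X ⊆ ℝ has a nontrivial connected component [a,b] with exactly one free endpoint (i.e., one endpoint is in the interior of [a,b] relative to X), then X is not a tame set in ℝ. -/
open Set

section Ends

variable {K : Type*} [TopologicalSpace K]

/-- `x` is the least point of `A` for some continuous real function that is injective on `A`. -/
def IsEndOf (A : Set K) (x : K) : Prop :=
  x ∈ A ∧ ∃ f : K → ℝ, Continuous f ∧ InjOn f A ∧ ∀ z ∈ A, f x ≤ f z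

/-- Some continuous injection into `ℝ` attains its minimum at `x` and its maximum at `y`. -/
def IsExtremePair (x y : K) : Prop :=
  ∃ f : K → ℝ, Continuous f ∧ Function.Injective f ∧ ∀ z, f x ≤ f z ∧ f z ≤ f y

/-- The connected component of `x` is nontrivial and not open. -/
def HasNonopenInterval (x : K) : Prop :=
  (connectedComponent x).Nontrivial ∧ ¬ IsOpen (connectedComponent x)

/-- Two continuous functions, injective on complementary clopen sets, glue to a continuous
injection which preserves their orders and puts the first set before the second. -/
theorem IsClopen.exists_glued_injection {A : Set K} (hA : IsClopen A) {f g : K → ℝ}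
    (hf : Continuous f) (hg : Continuous g) (hfA : InjOn f A) (hgA : InjOn g Aᶜ) :
    ∃ F : K → ℝ, Continuous F ∧ Function.Injective F ∧
      (∀ x ∈ A, ∀ y ∈ A, f x ≤ f y → F x ≤ F y) ∧
      (∀ x ∉ A, ∀ y ∉ A, g x ≤ g y → F x ≤ F y) ∧
      ∀ x ∈ A, ∀ y ∉ A, F x < F y := by
  classical
  set F := A.piecewise (fun x => -Real.exp (-f x)) (fun x => Real.exp (g x))
  have h1 : ∀ x ∈ A, F x = -Real.exp (-f x) := fun x hx => piecewise_eq_of_mem _ _ _ hx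
  have h2 : ∀ x ∉ A, F x = Real.exp (g x) := fun x hx => piecewise_eq_of_notMem _ _ _ hx
  have h3 : ∀ x ∈ A, ∀ y ∉ A, F x < F y := by
    intro x hx y hy
    rw [h1 x hx, h2 y hy]
    linarith [Real.exp_pos (-f x), Real.exp_pos (g y)]
  refine ⟨F, ?_, ?_, ?_, ?_, h3⟩
  · exact Continuous.piecewise (by simp [hA.frontier_eq]) (by fun_prop) (by fun_prop)
  · intro x y hxy
    by_cases hx : x ∈ A <;> by_cases hy : y ∈ A
    · rw [h1 x hx, h1 y hy] at hxy
      exact hfA hx hy (neg_injective (Real.exp_injective (neg_injective hxy)))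
    · exact absurd hxy (h3 x hx y hy).ne
    · exact absurd hxy (h3 y hy x hx).ne'
    · rw [h2 x hx, h2 y hy] at hxy
      exact hgA hx hy (Real.exp_injective hxy)
  · intro x hx y hy h
    rw [h1 x hx, h1 y hy]
    simpa using h
  · intro x hx y hy h
    rw [h2 x hx, h2 y hy]
    simpa using h

theorem IsEndOf.mono {A U : Set K} {x : K} (h : IsEndOf A x) (hA : IsClopen A) (hAU : A ⊆ U)
    {j : K → ℝ} (hj : Continuous j) (hji : Function.Injective j) : IsEndOf U x := by
  obtain ⟨hx, f, hf, hfA, hmin⟩ := h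
  obtain ⟨F, hF, hFi, hFA, -, hlt⟩ := hA.exists_glued_injection hf hj hfA hji.injOn
  refine ⟨hAU hx, F, hF, hFi.injOn, fun z _ => ?_⟩
  by_cases hz : z ∈ A
  · exact hFA x hx z hz (hmin z hz)
  · exact (hlt x hx z hz).le

theorem IsEndOf.isExtremePair {A B : Set K} {x y : K} (hx : IsEndOf A x) (hy : IsEndOf B y)
    (hA : IsClopen A) (hB : IsClopen B) (hAB : Disjoint A B)
    {j : K → ℝ} (hj : Continuous j) (hji : Function.Injective j) : IsExtremePair x y := by
  obtain ⟨hyA, g, hg, hgA, hgmin⟩ := hy.mono hB hAB.subset_compl_left hj hji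
  obtain ⟨hxA, f, hf, hfA, hfmin⟩ := hx
  obtain ⟨F, hF, hFi, hFA, hFB, hlt⟩ := hA.exists_glued_injection hf hg.neg hfA
    (fun u hu v hv h => hgA hu hv (neg_injective h))
  refine ⟨F, hF, hFi, fun z => ?_⟩
  by_cases hz : z ∈ A
  · exact ⟨hFA x hxA z hz (hfmin z hz), (hlt z hz y hyA).le⟩
  · exact ⟨(hlt x hxA z hz).le, hFB z hz y hyA (neg_le_neg (hgmin z hz))⟩

theorem IsEndOf.exists_isExtremePair [CompactSpace K] {x : K} (hx : IsEndOf univ x) :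
    ∃ y, IsExtremePair x y := by
  obtain ⟨-, f, hf, hfi, hmin⟩ := hx
  obtain ⟨y, -, hy⟩ := isCompact_univ.exists_isMaxOn ⟨x, mem_univ x⟩ hf.continuousOn
  exact ⟨y, f, hf, injOn_univ.mp hfi, fun z => ⟨hmin z (mem_univ z), hy (mem_univ z)⟩⟩

theorem IsClosed.exists_isEndOf [CompactSpace K] {A : Set K} (hA : IsClosed A)
    (hne : A.Nonempty) {j : K → ℝ} (hj : Continuous j) (hji : Function.Injective j) :
    ∃ x, IsEndOf A x := by
  obtain ⟨x, hx, hmin⟩ := hA.isCompact.exists_isMinOn hne hj.continuousOn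
  exact ⟨x, hx, j, hj, hji.injOn, fun z hz => hmin hz⟩

theorem HasNonopenInterval.image {x : K} (φ : K ≃ₜ K) (hx : HasNonopenInterval x) :
    HasNonopenInterval (φ x) := by
  have h : connectedComponent (φ x) = φ '' connectedComponent x := by
    have := φ.image_connectedComponentIn (mem_univ x)
    simpa [connectedComponentIn_univ] using this.symm
  rw [HasNonopenInterval, h, φ.isOpen_image]
  exact ⟨hx.1.image φ.injective, hx.2⟩

theorem hasNonopenInterval_homeomorph {x : K} (φ : K ≃ₜ K) :
    HasNonopenInterval (φ x) ↔ HasNonopenInterval x :=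
  ⟨fun h => by simpa using h.image φ.symm, fun h => h.image φ⟩

theorem exists_clopen_ssubset [T2Space K] [CompactSpace K] {c : K} {U : Set K}
    (hc : ¬ IsOpen (connectedComponent c)) (hU : IsClopen U) (hcU : c ∈ U) :
    ∃ V, IsClopen V ∧ c ∈ V ∧ V ⊆ U ∧ (U \ V).Nonempty := by
  have hsub : connectedComponent c ⊆ U := hU.connectedComponent_subset hcU
  obtain ⟨y, hyU, hy⟩ : ∃ y ∈ U, y ∉ connectedComponent c := by
    by_contra! h
    exact hc (Subset.antisymm hsub h ▸ hU.isOpen)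
  rw [connectedComponent_eq_iInter_isClopen, mem_iInter] at hy
  push Not at hy
  obtain ⟨⟨W, hW, hcW⟩, hyW⟩ := hy
  exact ⟨U ∩ W, hU.inter hW, ⟨hcU, hcW⟩, inter_subset_left, y, hyU, fun h => hyW h.2⟩

/-- A point whose component is trivial is a countable intersection of clopen sets. -/
theorem exists_nat_clopen_of_connectedComponent_eq_singleton [T2Space K] [CompactSpace K]
    [SecondCountableTopology K] {x : K} (hx : connectedComponent x = {x}) :
    ∃ U : ℕ → Set K, (∀ n, IsClopen (U n)) ∧ (∀ n, x ∈ U n) ∧ ∀ z ≠ x, ∃ n, z ∉ U n := by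
  obtain ⟨T, hT, hTU⟩ := TopologicalSpace.isOpen_iUnion_countable
    (fun s : { s : Set K // IsClopen s ∧ x ∈ s } => (s : Set K)ᶜ)
    (fun s => s.2.1.compl.isOpen)
  obtain ⟨u, hu⟩ := (hT.insert ⟨univ, isClopen_univ, mem_univ x⟩).exists_eq_range
    (insert_nonempty _ _)
  refine ⟨fun n => u n, fun n => (u n).2.1, fun n => (u n).2.2, fun z hz => ?_⟩
  have hzU : z ∈ ⋃ s : { s : Set K // IsClopen s ∧ x ∈ s }, (s : Set K)ᶜ := by
    rw [← compl_iInter, ← connectedComponent_eq_iInter_isClopen, hx]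
    exact hz
  rw [← hTU] at hzU
  simp only [mem_iUnion] at hzU
  obtain ⟨s, hs, hzs⟩ := hzU
  obtain ⟨n, rfl⟩ : s ∈ range u := hu ▸ mem_insert_of_mem _ hs
  exact ⟨n, hzs⟩

/-- A compact space embedded in the line can be re-embedded with a prescribed trivial component
as its least point. -/
theorem isEndOf_univ_of_connectedComponent_eq_singleton [T2Space K] [CompactSpace K]
    [SecondCountableTopology K] {x : K} (hx : connectedComponent x = {x})
    {j : K → ℝ} (hj : Continuous j) (hji : Function.Injective j) : IsEndOf univ x := by
  classical
  obtain ⟨U, hU, hxU, hsep⟩ := exists_nat_clopen_of_connectedComponent_eq_singleton hx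
  let N : K → ℕ := fun z => if hz : ∃ n, z ∉ U n then Nat.find hz else 0
  have hN : ∀ z, z ≠ x → z ∉ U (N z) ∧ ∀ m < N z, z ∈ U m := by
    intro z hz
    have h := hsep z hz
    simp only [N, dif_pos h]
    exact ⟨Nat.find_spec h, fun m hm => not_not.mp (Nat.find_min h hm)⟩
  let F : K → ℝ := fun z => if z = x then 0 else (1 / 2) ^ N z * (1 + Real.sigmoid (j z))
  have hFx : F x = 0 := if_pos rfl
  have hFz : ∀ z, z ≠ x → F z = (1 / 2) ^ N z * (1 + Real.sigmoid (j z)) :=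
    fun z hz => if_neg hz
  have hpos : ∀ z, 0 < Real.sigmoid (j z) := fun z => Real.sigmoid_pos _
  have hlt1 : ∀ z, Real.sigmoid (j z) < 1 := fun z => Real.sigmoid_lt_one _
  have hFpos : ∀ z, z ≠ x → 0 < F z := by
    intro z hz
    rw [hFz z hz]
    have := hpos z
    positivity
  have hFN : ∀ z w, z ≠ x → w ≠ x → N z < N w → F w < F z := by
    intro z w hz hw h
    rw [hFz z hz, hFz w hw]
    have h1 : ((1 : ℝ) / 2) ^ N w ≤ (1 / 2) ^ (N z + 1) :=
      pow_le_pow_of_le_one (by norm_num) (by norm_num) h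
    have h2 : (0 : ℝ) < (1 / 2) ^ N w := by positivity
    have h3 : (0 : ℝ) < (1 / 2) ^ N z := by positivity
    rw [pow_succ] at h1
    nlinarith [hpos z, hlt1 w, mul_pos h3 (hpos z), mul_pos h2 (sub_pos.2 (hlt1 w))]
  refine ⟨mem_univ x, F, ?_, ?_, ?_⟩
  · rw [continuous_iff_continuousAt]
    intro w
    by_cases hw : w = x
    · subst hw
      rw [ContinuousAt, hFx, Metric.tendsto_nhds]
      intro ε hε
      obtain ⟨n, hn⟩ := exists_pow_lt_of_lt_one (half_pos hε) (by norm_num : (1 / 2 : ℝ) < 1)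
      have hev : ∀ᶠ z in nhds w, ∀ m ∈ Finset.range (n + 1), z ∈ U m :=
        (Filter.eventually_all_finset _).2 fun m _ => (hU m).isOpen.mem_nhds (hxU m)
      filter_upwards [hev] with z hz
      by_cases hzw : z = w
      · simpa [hzw, hFx] using hε
      · rw [Real.dist_eq, sub_zero, abs_of_pos (hFpos z hzw), hFz z hzw]
        have hnN : n ≤ N z := by
          by_contra! h
          exact (hN z hzw).1 (hz _ (Finset.mem_range.2 (by omega)))
        have h1 : ((1 : ℝ) / 2) ^ N z ≤ (1 / 2) ^ n :=
          pow_le_pow_of_le_one (by norm_num) (by norm_num) hnN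
        have h2 : (0 : ℝ) < (1 / 2) ^ N z := by positivity
        nlinarith [hlt1 z, mul_pos h2 (sub_pos.2 (hlt1 z))]
    · have hev : ∀ᶠ z in nhds w, ∀ m ∈ Finset.range (N w), z ∈ U m :=
        (Filter.eventually_all_finset _).2 fun m hm =>
          (hU m).isOpen.mem_nhds ((hN w hw).2 m (Finset.mem_range.1 hm))
      have hev' : ∀ᶠ z in nhds w, z ∈ (U (N w))ᶜ :=
        (hU (N w)).compl.isOpen.mem_nhds (hN w hw).1
      have hcont : ContinuousAt (fun z => (1 / 2 : ℝ) ^ N w * (1 + Real.sigmoid (j z))) w := by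
        have := continuous_sigmoid.comp hj
        exact (continuous_const.mul (continuous_const.add this)).continuousAt
      refine hcont.congr ?_
      filter_upwards [hev, hev'] with z hz hz'
      have hzx : z ≠ x := fun h => hz' (h ▸ hxU _)
      have hNz : N z = N w := by
        rcases lt_trichotomy (N z) (N w) with h | h | h
        · exact absurd (hz _ (Finset.mem_range.2 h)) (hN z hzx).1
        · exact h
        · exact absurd ((hN z hzx).2 _ h) hz'
      rw [hFz z hzx, hNz]
  · intro z _ w _ h
    by_cases hz : z = x <;> by_cases hw : w = x
    · rw [hz, hw]
    · rw [hz, hFx] at h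
      exact absurd h (hFpos w hw).ne
    · rw [hw, hFx] at h
      exact absurd h (hFpos z hz).ne'
    · rcases lt_trichotomy (N z) (N w) with hN' | hN' | hN'
      · exact absurd h (hFN z w hz hw hN').ne'
      · rw [hFz z hz, hFz w hw, hN'] at h
        have h' := mul_left_cancel₀ (by positivity) h
        exact hji (Real.sigmoid_strictMono.injective (add_left_cancel h'))
      · exact absurd h (hFN w z hw hz hN').ne
  · intro z _
    by_cases hz : z = x
    · rw [hz]
    · rw [hFx]
      exact (hFpos z hz).le

/-- A nonempty compact space with countably many components has an open component. -/
theorem exists_isOpen_connectedComponent [T2Space K] [CompactSpace K] [Nonempty K]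
    [Countable (ConnectedComponents K)] : ∃ x : K, IsOpen (connectedComponent x) := by
  obtain ⟨q, hq⟩ := nonempty_interior_of_iUnion_of_closed
    (f := fun q : ConnectedComponents K => {q}) (fun _ => isClosed_singleton)
    (iUnion_of_singleton _)
  obtain ⟨x, rfl⟩ := ConnectedComponents.surjective_coe q
  refine ⟨x, ?_⟩
  rw [← connectedComponents_preimage_singleton]
  refine IsOpen.preimage ConnectedComponents.continuous_coe ?_
  rw [← interior_eq_iff_isOpen]
  exact hq.subset_singleton_iff.1 interior_subset

end Ends

theorem countable_connectedComponents_of_nontrivial {X : Set ℝ}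
    (h : ∀ x : X, (connectedComponent x).Nontrivial) : Countable (ConnectedComponents X) := by
  have hq : ∀ x : X, ∃ q : ℚ, ∃ y ∈ connectedComponent x, (y : ℝ) = q := by
    intro x
    obtain ⟨u, hu, v, hv, huv⟩ := h x
    wlog hlt : u < v generalizing u v
    · exact this v hv u hu huv.symm (lt_of_le_of_ne (not_lt.1 hlt) huv.symm)
    obtain ⟨q, hq1, hq2⟩ := exists_rat_btwn (show (u : ℝ) < v from hlt)
    have hpre : IsPreconnected ((↑) '' connectedComponent x : Set ℝ) :=
      isPreconnected_connectedComponent.image _ continuous_subtype_val.continuousOn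
    obtain ⟨y, hy, hyq⟩ := hpre.ordConnected.out (mem_image_of_mem _ hu) (mem_image_of_mem _ hv)
      ⟨hq1.le, hq2.le⟩
    exact ⟨q, y, hy, hyq⟩
  choose r y hy hyr using hq
  have hinj : Function.Injective fun c : ConnectedComponents X => r c.out := by
    intro c d hcd
    have hcd' : y c.out = y d.out := by
      apply Subtype.ext
      rw [hyr, hyr]
      exact congrArg _ hcd
    have h1 := connectedComponent_eq (hy c.out)
    have h2 := connectedComponent_eq (hy d.out)
    rw [hcd', ← h2] at h1
    rw [← Quotient.out_eq c, ← Quotient.out_eq d]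
    exact Quotient.sound h1
  exact hinj.countable

theorem exists_isEndOf_univ_not_hasNonopenInterval {X : Set ℝ} [CompactSpace X] [Nonempty X] :
    ∃ x : X, IsEndOf univ x ∧ ¬ HasNonopenInterval x := by
  by_cases h : ∀ x : X, (connectedComponent x).Nontrivial
  · have := countable_connectedComponents_of_nontrivial h
    obtain ⟨c, hc⟩ := exists_isOpen_connectedComponent (K := X)
    obtain ⟨x, hx⟩ := isClosed_connectedComponent.exists_isEndOf ⟨c, mem_connectedComponent⟩
      continuous_subtype_val Subtype.val_injective
    refine ⟨x, hx.mono ⟨isClosed_connectedComponent, hc⟩ (subset_univ _)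
      continuous_subtype_val Subtype.val_injective, fun hP => hP.2 ?_⟩
    rwa [← connectedComponent_eq hx.1]
  · push Not at h
    obtain ⟨x, hx⟩ := h
    have hx' : connectedComponent x = {x} :=
      hx.eq_singleton_of_mem mem_connectedComponent
    refine ⟨x, isEndOf_univ_of_connectedComponent_eq_singleton hx'
      continuous_subtype_val Subtype.val_injective, fun hP => ?_⟩
    exact not_subsingleton_iff.2 hP.1 hx

/-- Tameness allows comparing the extreme points of any two embeddings. -/
theorem IsTame.hasNonopenInterval_extremePair {X : Set ℝ} [CompactSpace X] (hX : IsTame X)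
    {m M x y : X} (hm : ∀ z : X, m ≤ z) (hM : ∀ z : X, z ≤ M) (hxy : IsExtremePair x y) :
    ((HasNonopenInterval x ↔ HasNonopenInterval m) ∧
      (HasNonopenInterval y ↔ HasNonopenInterval M)) ∨
    ((HasNonopenInterval x ↔ HasNonopenInterval M) ∧
      (HasNonopenInterval y ↔ HasNonopenInterval m)) := by
  obtain ⟨F, hF, hFi, hext⟩ := hxy
  have hemb : Topology.IsEmbedding F := (hF.isClosedEmbedding hFi).isEmbedding
  obtain ⟨f, hf⟩ := hX (range F) ⟨hemb.toHomeomorph⟩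
  let φ : X ≃ₜ X := (f.image X).trans ((Homeomorph.setCongr hf).trans hemb.toHomeomorph.symm)
  have hφ : ∀ z, F (φ z) = f z := by
    intro z
    have : hemb.toHomeomorph (φ z) = Homeomorph.setCongr hf (f.image X z) := by simp [φ]
    exact congrArg Subtype.val this
  have hle : ∀ z : X, F x ≤ f z ∧ f z ≤ F y := fun z => hφ z ▸ hext (φ z)
  have key : ∀ {u v : X}, F u = f v → (HasNonopenInterval u ↔ HasNonopenInterval v) := by
    intro u v huv
    rw [← hφ v] at huv
    rw [hFi huv, hasNonopenInterval_homeomorph]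
  have hx : F x = f (φ.symm x) := by rw [← hφ, φ.apply_symm_apply]
  have hy : F y = f (φ.symm y) := by rw [← hφ, φ.apply_symm_apply]
  rcases f.continuous.strictMono_of_inj f.injective with hmono | hanti
  · left
    exact ⟨key (le_antisymm (hle m).1 (hx ▸ hmono.monotone (hm _))),
      key (le_antisymm (hy ▸ hmono.monotone (hM _)) (hle M).2)⟩
  · right
    exact ⟨key (le_antisymm (hle M).1 (hx ▸ hanti.antitone (hM _))),
      key (le_antisymm (hy ▸ hanti.antitone (hm _)) (hle m).2)⟩

/-- A compact set having an embedding whose least point lies in a nonopen interval component is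
not tame. -/
theorem not_isTame_of_isEndOf_univ {X : Set ℝ} [CompactSpace X] {e : X}
    (he : IsEndOf univ e) (hP : HasNonopenInterval e) : ¬ IsTame X := by
  intro hX
  have hj : Continuous (Subtype.val : X → ℝ) := continuous_subtype_val
  have hji : Function.Injective (Subtype.val : X → ℝ) := Subtype.val_injective
  have : Nonempty X := ⟨e⟩
  obtain ⟨m, -, hm⟩ := isCompact_univ.exists_isMinOn ⟨e, mem_univ e⟩ hj.continuousOn
  obtain ⟨M, -, hM⟩ := isCompact_univ.exists_isMaxOn ⟨e, mem_univ e⟩ hj.continuousOn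
  have compare := fun {x y : X} (h : IsExtremePair x y) =>
    hX.hasNonopenInterval_extremePair (m := m) (M := M)
      (fun z => hm (mem_univ z)) (fun z => hM (mem_univ z)) h
  obtain ⟨e', hee'⟩ := he.exists_isExtremePair
  obtain ⟨t, ht, htP⟩ := exists_isEndOf_univ_not_hasNonopenInterval (X := X)
  obtain ⟨t', htt'⟩ := ht.exists_isExtremePair
  obtain ⟨U, hU, heU, -, hU'⟩ := exists_clopen_ssubset hP.2 isClopen_univ (mem_univ e)
  obtain ⟨V, hV, heV, hVU, hUV⟩ := exists_clopen_ssubset hP.2 hU heU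
  rw [← compl_eq_univ_sdiff] at hU'
  obtain ⟨p, hp⟩ := hU.compl.isClosed.exists_isEndOf hU' hj hji
  obtain ⟨q, hq⟩ := (hU.diff hV).isClosed.exists_isEndOf hUV hj hji
  obtain ⟨r, hr⟩ := hV.isClosed.exists_isEndOf ⟨e, heV⟩ hj hji
  have hpq := compare (hp.isExtremePair hq hU.compl (hU.diff hV)
    (disjoint_compl_left.mono_right sdiff_subset) hj hji)
  have hpr := compare (hp.isExtremePair hr hU.compl hV
    (disjoint_compl_left.mono_right hVU) hj hji)
  have hqr := compare (hq.isExtremePair hr (hU.diff hV) hV disjoint_sdiff_left hj hji)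
  have h1 := compare hee'
  have h2 := compare htt'
  by_cases hmP : HasNonopenInterval m <;> by_cases hMP : HasNonopenInterval M <;>
    simp only [hP, htP, hmP, hMP, iff_true, iff_false] at * <;> tauto

theorem isEndOf_univ_of_mem_nhds {K : Type*} [TopologicalSpace K] {f : K → ℝ}
    (hf : Continuous f) (hfi : Function.Injective f) {e : K} {C : Set K} (hC : C ∈ nhds e)
    (he : ∀ z ∈ C, f e ≤ f z) : IsEndOf univ e := by
  have hcl : IsClopen {z | f e ≤ f z} := by
    refine ⟨isClosed_le continuous_const hf, isOpen_iff_mem_nhds.2 fun z hz => ?_⟩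
    rcases eq_or_lt_of_le (show f e ≤ f z from hz) with h | h
    · rw [← hfi h]
      exact Filter.mem_of_superset hC he
    · exact Filter.mem_of_superset ((isOpen_lt continuous_const hf).mem_nhds h)
        fun w (hw : f e < f w) => hw.le
  exact IsEndOf.mono ⟨le_refl (f e), f, hf, hfi.injOn, fun z hz => hz⟩ hcl (subset_univ _) hf hfi

theorem mem_nhds_of_notMem_closure {X : Set ℝ} {C : Set X} {e : X}
    (he : (e : ℝ) ∉ closure (X \ (↑) '' C)) : C ∈ nhds e := by
  have h := continuous_subtype_val.continuousAt.preimage_mem_nhds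
    (isClosed_closure.isOpen_compl.mem_nhds he)
  refine Filter.mem_of_superset h fun z hz => ?_
  by_contra hzC
  exact hz (subset_closure ⟨z.2, by simpa using hzC⟩)

theorem not_isOpen_of_mem_closure {X : Set ℝ} {C : Set X} {e : X} (heC : e ∈ C)
    (he : (e : ℝ) ∈ closure (X \ (↑) '' C)) : ¬ IsOpen C := by
  rintro ⟨O, hO, rfl⟩
  obtain ⟨y, hyO, hyX, hy⟩ := mem_closure_iff.1 he O hO heC
  exact hy ⟨⟨y, hyX⟩, hyO, rfl⟩

theorem not_tame_of_one_free_endpoint (X : Set ℝ) (hX : IsCompact X)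
    (I : Set ℝ) (hI : I ∈ intervalsOf X) (a b : ℝ)
    (ha : IsLeast I a) (hb : IsGreatest I b)
    (hone : Xor' (a ∉ closure (X \ I)) (b ∉ closure (X \ I))) :
    ¬ IsTame X := by
  obtain ⟨⟨x, hx, rfl⟩, hnt⟩ := hI
  rw [connectedComponentIn_eq_image hx] at ha hb hone hnt
  set C := connectedComponent (⟨x, hx⟩ : X)
  have : CompactSpace X := isCompact_iff_compactSpace.1 hX
  obtain ⟨⟨a, haC, rfl⟩, ha⟩ := ha
  obtain ⟨⟨b, hbC, rfl⟩, hb⟩ := hb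
  have hP : ∀ e ∈ C, ¬ IsOpen C → HasNonopenInterval e := by
    intro e he hC
    rw [HasNonopenInterval, ← connectedComponent_eq he]
    exact ⟨nontrivial_of_image _ _ hnt, hC⟩
  rcases hone with ⟨hfree, hlim⟩ | ⟨hfree, hlim⟩
  · have hC := not_isOpen_of_mem_closure hbC (not_not.1 hlim)
    refine not_isTame_of_isEndOf_univ (e := a) ?_ (hP a haC hC)
    exact isEndOf_univ_of_mem_nhds continuous_subtype_val Subtype.val_injective
      (mem_nhds_of_notMem_closure hfree) fun z hz => ha (mem_image_of_mem _ hz)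
  · have hC := not_isOpen_of_mem_closure haC (not_not.1 hlim)
    refine not_isTame_of_isEndOf_univ (e := b) ?_ (hP b hbC hC)
    exact isEndOf_univ_of_mem_nhds continuous_subtype_val.neg
      (neg_injective.comp Subtype.val_injective)
      (mem_nhds_of_notMem_closure hfree) fun z hz => neg_le_neg (hb (mem_image_of_mem _ hz))
end

section
/- Let X ⊆ ℝ be compact with no nontrivial connected components. Then X is a tame set in ℝ if and only if X is finite or X is homeomorphic to the Cantor set. -/
open Set

open Filter Topology

/-- In a nonempty compact set of reals, a point is left of it, right of it, in it, or in a bounded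
gap. -/
theorem IsCompact.lt_or_gt_or_mem_or_gap {C : Set ℝ} (hC : IsCompact C) {m M : ℝ}
    (hm : IsLeast C m) (hM : IsGreatest C M) (x : ℝ) :
    x < m ∨ M < x ∨ x ∈ C ∨ ∃ a ∈ C, ∃ b ∈ C, a < x ∧ x < b ∧ ∀ c ∈ C, c ≤ a ∨ b ≤ c := by
  by_cases h1 : x < m
  · exact Or.inl h1
  by_cases h2 : M < x
  · exact Or.inr (Or.inl h2)
  by_cases h3 : x ∈ C
  · exact Or.inr (Or.inr (Or.inl h3))
  refine Or.inr (Or.inr (Or.inr ?_))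
  obtain ⟨a, ⟨haC, hax⟩, ha⟩ := (hC.inter_right isClosed_Iic).exists_isGreatest
    (⟨m, hm.1, not_lt.1 h1⟩ : (C ∩ Iic x).Nonempty)
  obtain ⟨b, ⟨hbC, hxb⟩, hb⟩ := (hC.inter_right isClosed_Ici).exists_isLeast
    (⟨M, hM.1, not_lt.1 h2⟩ : (C ∩ Ici x).Nonempty)
  refine ⟨a, haC, b, hbC, lt_of_le_of_ne hax ?_, lt_of_le_of_ne hxb ?_, fun c hc => ?_⟩
  · rintro rfl; exact h3 haC
  · rintro rfl; exact h3 hbC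
  · rcases le_total c x with h | h
    · exact Or.inl (ha ⟨hc, h⟩)
    · exact Or.inr (hb ⟨hc, h⟩)

/-- A strictly increasing map between compact sets of reals extends to a homeomorphism of `ℝ`. -/
theorem StrictMonoOn.exists_homeomorph_eqOn {C : Set ℝ} (hC : IsCompact C) {p : ℝ → ℝ}
    (hp : StrictMonoOn p C) (hD : IsCompact (p '' C)) : ∃ f : ℝ ≃ₜ ℝ, EqOn f p C := by
  classical
  rcases C.eq_empty_or_nonempty with rfl | hne
  · exact ⟨Homeomorph.refl ℝ, by simp⟩
  obtain ⟨m, hm⟩ := hC.exists_isLeast hne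
  obtain ⟨M, hM⟩ := hC.exists_isGreatest hne
  set F : ℝ → ℝ := fun x =>
    if x < m then p m + (x - m) else if M < x then p M + (x - M) else
      p (sSup (C ∩ Iic x)) + (p (sInf (C ∩ Ici x)) - p (sSup (C ∩ Iic x))) /
        (sInf (C ∩ Ici x) - sSup (C ∩ Iic x)) * (x - sSup (C ∩ Iic x)) with hF
  have Flow : ∀ x < m, F x = p m + (x - m) := fun x hx => by simp [hF, hx]
  have hmM : m ≤ M := hm.2 hM.1
  have Fhigh : ∀ x, M < x → F x = p M + (x - M) := fun x hx => by
    simp [hF, hx, not_lt.2 (hmM.trans hx.le)]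
  have Fmem : ∀ x ∈ C, F x = p x := fun x hx => by
    have h1 : sSup (C ∩ Iic x) = x :=
      IsGreatest.csSup_eq ⟨⟨hx, self_mem_Iic⟩, fun y hy => hy.2⟩
    simp [hF, not_lt.2 (hm.2 hx), not_lt.2 (hM.2 hx), h1]
  have Fgap : ∀ x, ∀ a ∈ C, ∀ b ∈ C, a < x → x < b → (∀ c ∈ C, c ≤ a ∨ b ≤ c) →
      F x = p a + (p b - p a) / (b - a) * (x - a) := fun x a ha b hb hax hxb hab => by
    have h1 : sSup (C ∩ Iic x) = a :=
      IsGreatest.csSup_eq ⟨⟨ha, hax.le⟩, fun y hy => (hab y hy.1).resolve_right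
        (fun h => absurd (mem_Iic.1 hy.2) (by linarith))⟩
    have h2 : sInf (C ∩ Ici x) = b :=
      IsLeast.csInf_eq ⟨⟨hb, hxb.le⟩, fun y hy => (hab y hy.1).resolve_left
        (fun h => absurd (mem_Ici.1 hy.2) (by linarith))⟩
    have h3 := hm.2 ha
    have h4 := hM.2 hb
    simp only [hF, h1, h2, if_neg (show ¬ x < m by linarith), if_neg (show ¬ M < x by linarith)]
  have slope : ∀ a ∈ C, ∀ b ∈ C, a < b → 0 < (p b - p a) / (b - a) := fun a ha b hb hab =>
    div_pos (sub_pos.2 (hp ha hb hab)) (sub_pos.2 hab)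
  have Fend : ∀ x a b, a < b → (p b - p a) / (b - a) * (x - a) =
      (p b - p a) - (p b - p a) / (b - a) * (b - x) := fun x a b hab => by
    have : b - a ≠ 0 := (sub_pos.2 hab).ne'
    field_simp
    ring
  have Flt : ∀ x, ∀ c ∈ C, x < c → F x < p c := fun x c hc hxc => by
    rcases hC.lt_or_gt_or_mem_or_gap hm hM x with h | h | h | ⟨a, ha, b, hb, hax, hxb, hab⟩
    · rw [Flow x h]
      have := hp.monotoneOn hm.1 hc (hm.2 hc)
      linarith
    · exact absurd (hM.2 hc) (by linarith)
    · rw [Fmem x h]; exact hp h hc hxc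
    · have hbc : b ≤ c := (hab c hc).resolve_left (by linarith)
      have h1 := hp.monotoneOn hb hc hbc
      rw [Fgap x a ha b hb hax hxb hab, Fend x a b (hax.trans hxb)]
      have := mul_pos (slope a ha b hb (hax.trans hxb)) (sub_pos.2 hxb)
      linarith
  have Fgt : ∀ x, ∀ c ∈ C, c < x → p c < F x := fun x c hc hcx => by
    rcases hC.lt_or_gt_or_mem_or_gap hm hM x with h | h | h | ⟨a, ha, b, hb, hax, hxb, hab⟩
    · exact absurd (hm.2 hc) (by linarith)
    · rw [Fhigh x h]
      have := hp.monotoneOn hc hM.1 (hM.2 hc)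
      linarith
    · rw [Fmem x h]; exact hp hc h hcx
    · have hca : c ≤ a := (hab c hc).resolve_right (by linarith)
      have h1 := hp.monotoneOn hc ha hca
      rw [Fgap x a ha b hb hax hxb hab]
      have := mul_pos (slope a ha b hb (hax.trans hxb)) (sub_pos.2 hax)
      linarith
  have Fmono : StrictMono F := fun x y hxy => by
    by_cases hc : ∃ c ∈ C, x ≤ c ∧ c ≤ y
    · obtain ⟨c, hc, hxc, hcy⟩ := hc
      rcases hxc.eq_or_lt with rfl | hxc
      · rw [Fmem x hc]; exact Fgt y x hc hxy
      · rcases hcy.eq_or_lt with rfl | hcy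
        · rw [Fmem c hc]; exact Flt x c hc hxc
        · exact (Flt x c hc hxc).trans (Fgt y c hc hcy)
    · push Not at hc
      rcases hC.lt_or_gt_or_mem_or_gap hm hM x with h | h | h | ⟨a, ha, b, hb, hax, hxb, hab⟩
      · rw [Flow x h, Flow y (hc m hm.1 h.le)]; linarith
      · rw [Fhigh x h, Fhigh y (h.trans hxy)]; linarith
      · exact absurd (hc x h le_rfl) (by linarith)
      · have hyb := hc b hb hxb.le
        rw [Fgap x a ha b hb hax hxb hab, Fgap y a ha b hb (hax.trans hxy) hyb hab]
        have := mul_lt_mul_of_pos_left (sub_lt_sub_right hxy a) (slope a ha b hb (hax.trans hxb))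
        linarith
  have Dm : IsLeast (p '' C) (p m) := hp.monotoneOn.map_isLeast hm
  have DM : IsGreatest (p '' C) (p M) := hp.monotoneOn.map_isGreatest hM
  have Fsurj : Function.Surjective F := fun y => by
    rcases hD.lt_or_gt_or_mem_or_gap Dm DM y with h | h | ⟨x, hx, rfl⟩ |
      ⟨_, ⟨a, ha, rfl⟩, _, ⟨b, hb, rfl⟩, hay, hyb, hab⟩
    · exact ⟨m + (y - p m), by rw [Flow _ (by linarith)]; ring⟩
    · exact ⟨M + (y - p M), by rw [Fhigh _ (by linarith)]; ring⟩
    · exact ⟨x, Fmem x hx⟩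
    · have hlt : a < b := (hp.lt_iff_lt ha hb).1 (hay.trans hyb)
      have hs := slope a ha b hb hlt
      have hgap : ∀ c ∈ C, c ≤ a ∨ b ≤ c := fun c hc =>
        (hab (p c) ⟨c, hc, rfl⟩).imp (hp.le_iff_le hc ha).1 (hp.le_iff_le hb hc).1
      have hx : (p b - p a) / (b - a) * ((y - p a) / ((p b - p a) / (b - a))) = y - p a :=
        mul_div_cancel₀ _ hs.ne'
      refine ⟨a + (y - p a) / ((p b - p a) / (b - a)), ?_⟩
      rw [Fgap _ a ha b hb _ _ hgap, add_sub_cancel_left, hx]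
      · ring
      · have := div_pos (sub_pos.2 hay) hs
        linarith
      · rw [← lt_sub_iff_add_lt', div_lt_iff₀ hs, mul_div_cancel₀ _ (sub_pos.2 hlt).ne']
        linarith
  exact ⟨(Fmono.orderIsoOfSurjective F Fsurj).toHomeomorph, fun x hx => Fmem x hx⟩

/-- Order isomorphic compact sets of reals are ambiently homeomorphic. -/
theorem IsCompact.exists_homeomorph_image_eq {C D : Set ℝ} (hC : IsCompact C) (hD : IsCompact D)
    (e : C ≃o D) : ∃ f : ℝ ≃ₜ ℝ, f '' C = D := by
  classical
  let p : ℝ → ℝ := fun x => if h : x ∈ C then e ⟨x, h⟩ else 0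
  have hpC : ∀ x (h : x ∈ C), p x = e ⟨x, h⟩ := fun x h => dif_pos h
  have hp : StrictMonoOn p C := fun x hx y hy hxy => by
    rw [hpC x hx, hpC y hy]
    exact e.strictMono (show (⟨x, hx⟩ : C) < ⟨y, hy⟩ from hxy)
  have himg : p '' C = D := by
    ext y
    constructor
    · rintro ⟨x, hx, rfl⟩
      rw [hpC x hx]
      exact (e _).2
    · intro hy
      refine ⟨e.symm ⟨y, hy⟩, (e.symm ⟨y, hy⟩).2, ?_⟩
      rw [hpC _ (e.symm ⟨y, hy⟩).2]
      simp
  obtain ⟨f, hf⟩ := hp.exists_homeomorph_eqOn hC (himg ▸ hD)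
  exact ⟨f, by rw [hf.image_eq, himg]⟩

/-- The left endpoints of the bounded gaps of a set of reals. -/
def leftEnds (C : Set ℝ) : Set ℝ := {a ∈ C | ∃ b ∈ C, a < b ∧ ∀ c ∈ C, c ≤ a ∨ b ≤ c}

theorem countable_leftEnds (C : Set ℝ) : (leftEnds C).Countable := by
  have h : ∀ a, ∃ b, a ∈ leftEnds C → b ∈ C ∧ a < b ∧ ∀ c ∈ C, c ≤ a ∨ b ≤ c := fun a => by
    by_cases ha : a ∈ leftEnds C
    · obtain ⟨b, hb⟩ := ha.2
      exact ⟨b, fun _ => hb⟩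
    · exact ⟨0, fun h => absurd h ha⟩
  choose r hr using h
  refine Set.PairwiseDisjoint.countable_of_Ioo (y := r) ?_ fun a ha => (hr a ha).2.1
  intro a ha a' ha' hne
  refine Set.disjoint_left.2 fun x hx hx' => ?_
  rcases lt_or_gt_of_ne hne with h | h
  · have := ((hr a ha).2.2 a' ha'.1).resolve_left (not_le.2 h)
    linarith [hx.2, hx'.1]
  · have := ((hr a' ha').2.2 a ha.1).resolve_left (not_le.2 h)
    linarith [hx'.2, hx.1]

theorem IsTotallyDisconnected.exists_notMem_Ioo {C : Set ℝ} (hC : IsTotallyDisconnected C)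
    {x y : ℝ} (hxy : x < y) : ∃ z ∈ Ioo x y, z ∉ C := by
  by_contra! h
  obtain ⟨u, hu⟩ := exists_between hxy
  obtain ⟨v, hv⟩ := exists_between hu.2
  have := hC (Ioo x y) h isPreconnected_Ioo hu (⟨hu.1.trans hv.1, hv.2⟩ : v ∈ Ioo x y)
  exact hv.1.ne this

theorem IsCompact.exists_mem_leftEnds {C : Set ℝ} (hC : IsCompact C)
    (hd : IsTotallyDisconnected C) {x y : ℝ} (hx : x ∈ C) (hy : y ∈ C) (hxy : x < y) :
    ∃ l ∈ leftEnds C, x ≤ l ∧ l < y := by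
  obtain ⟨z, hz, hzC⟩ := hd.exists_notMem_Ioo hxy
  obtain ⟨m, hm⟩ := hC.exists_isLeast ⟨x, hx⟩
  obtain ⟨M, hM⟩ := hC.exists_isGreatest ⟨x, hx⟩
  rcases hC.lt_or_gt_or_mem_or_gap hm hM z with h | h | h | ⟨a, ha, b, hb, haz, hzb, hab⟩
  · exact absurd (hm.2 hx) (by linarith [hz.1])
  · exact absurd (hM.2 hy) (by linarith [hz.2])
  · exact absurd h hzC
  · exact ⟨a, ⟨ha, b, hb, haz.trans hzb, hab⟩, (hab x hx).resolve_right (by linarith [hz.1]),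
      haz.trans hz.2⟩

/-- A compact totally disconnected set of reals is the completion of its set of left endpoints. -/
theorem IsCompact.nonempty_orderIso_lowerSet_leftEnds {C : Set ℝ} (hC : IsCompact C)
    (hd : IsTotallyDisconnected C) (hne : C.Nonempty) :
    Nonempty (C ≃o LowerSet (leftEnds C)) := by
  classical
  let F : C → LowerSet (leftEnds C) := fun x => ⟨{l | (l : ℝ) < x}, fun a b hba ha =>
    lt_of_le_of_lt (show (b : ℝ) ≤ a from hba) ha⟩
  have hmono : StrictMono F := fun x y hxy => by
    obtain ⟨l, hl, hxl, hly⟩ := hC.exists_mem_leftEnds hd x.2 y.2 hxy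
    refine lt_of_le_not_ge (fun a (ha : (a : ℝ) < x) => show (a : ℝ) < y from
      ha.trans hxy) fun h => ?_
    have : l < x := h (show (⟨l, hl⟩ : leftEnds C) ∈ F y from hly)
    linarith
  have hsurj : Function.Surjective F := fun A => by
    obtain ⟨M, hM⟩ := hC.exists_isGreatest hne
    let S : Set ℝ := {y ∈ C | ∀ l ∈ A, (l : ℝ) < y}
    have hlM : ∀ l ∈ leftEnds C, l < M := fun l hl => by
      obtain ⟨b, hb, hlb, -⟩ := hl.2
      exact hlb.trans_le (hM.2 hb)
    have hS : S.Nonempty := ⟨M, hM.1, fun l _ => hlM l l.2⟩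
    have hScl : IsClosed S := by
      have : S = C ∩ ⋂ l ∈ A, Ici (Classical.choose (l : leftEnds C).2.2) := by
        ext y
        simp only [S, mem_ofPred_eq, mem_inter_iff, mem_iInter, mem_Ici]
        refine and_congr_right fun hy => forall₂_congr fun l hl => ?_
        obtain ⟨-, h1, h2⟩ := Classical.choose_spec l.2.2
        exact ⟨fun h => (h2 y hy).resolve_left (not_le.2 h), fun h => h1.trans_le h⟩
      rw [this]
      exact hC.isClosed.inter (isClosed_biInter fun _ _ => isClosed_Ici)
    obtain ⟨x, hx⟩ := (hC.of_isClosed_subset hScl fun y hy => hy.1).exists_isLeast hS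
    refine ⟨⟨x, hx.1.1⟩, ?_⟩
    ext l
    constructor
    · intro (hl : (l : ℝ) < x)
      by_contra hlA
      refine absurd (hx.2 (⟨l.2.1, fun a ha => lt_of_not_ge fun h => hlA (A.lower h ha)⟩ :
        (l : ℝ) ∈ S)) (not_le.2 hl)
    · intro hl
      exact hx.1.2 l hl
  exact ⟨hmono.orderIsoOfSurjective F hsurj⟩

/-- In a preperfect set of reals, no point is separated on both sides from the rest. -/
theorem Preperfect.exists_mem_Ioo_ne {C : Set ℝ} (hp : Preperfect C) {x u v : ℝ} (hx : x ∈ C)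
    (hux : u < x) (hxv : x < v) : ∃ y ∈ C, y ∈ Ioo u v ∧ y ≠ x := by
  obtain ⟨y, hy, hne⟩ := accPt_iff_nhds.1 (hp x hx) (Ioo u v) (Ioo_mem_nhds hux hxv)
  exact ⟨y, hy.2, hy.1, hne⟩

theorem Preperfect.nonempty_leftEnds_orderIso_rat {C : Set ℝ} (hp : Preperfect C)
    (hC : IsCompact C) (hd : IsTotallyDisconnected C) (hne : C.Nonempty) :
    Nonempty (leftEnds C ≃o ℚ) := by
  have : Countable (leftEnds C) := (countable_leftEnds C).to_subtype
  obtain ⟨m, hm⟩ := hC.exists_isLeast hne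
  obtain ⟨M, hM⟩ := hC.exists_isGreatest hne
  have hne : Nonempty (leftEnds C) := by
    obtain ⟨y, hy, -, hne⟩ := hp.exists_mem_Ioo_ne hm.1 (sub_one_lt m) (lt_add_one m)
    obtain ⟨l, hl, -⟩ := hC.exists_mem_leftEnds hd hm.1 hy (lt_of_le_of_ne (hm.2 hy) hne.symm)
    exact ⟨l, hl⟩
  have hmin : NoMinOrder (leftEnds C) := ⟨fun ⟨a, haC, b, hb, hab, hgap⟩ => by
    have hma : m < a := by
      refine lt_of_le_of_ne (hm.2 haC) ?_
      rintro rfl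
      obtain ⟨y, hy, hyI, hne⟩ := hp.exists_mem_Ioo_ne haC (sub_one_lt m) hab
      rcases hgap y hy with h | h
      · exact hne (le_antisymm h (hm.2 hy))
      · exact absurd hyI.2 (not_lt.2 h)
    obtain ⟨l, hl, -, hla⟩ := hC.exists_mem_leftEnds hd hm.1 haC hma
    exact ⟨⟨l, hl⟩, hla⟩⟩
  have hmax : NoMaxOrder (leftEnds C) := ⟨fun ⟨a, haC, b, hb, hab, hgap⟩ => by
    have hbM : b < M := by
      refine lt_of_le_of_ne (hM.2 hb) ?_
      rintro rfl
      obtain ⟨y, hy, hyI, hne⟩ := hp.exists_mem_Ioo_ne hb hab (lt_add_one b)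
      rcases hgap y hy with h | h
      · exact absurd hyI.1 (not_lt.2 h)
      · exact hne (le_antisymm (hM.2 hy) h)
    obtain ⟨l, hl, hbl, -⟩ := hC.exists_mem_leftEnds hd hb hM.1 hbM
    exact ⟨⟨l, hl⟩, show a < l from hab.trans_le hbl⟩⟩
  have hdense : DenselyOrdered (leftEnds C) := ⟨fun ⟨a, haC, b, hb, hab, hgap⟩ ⟨a', haC', b', hb',
      hab', hgap'⟩ h => by
    change a < a' at h
    have hba : b < a' := by
      refine lt_of_le_of_ne ((hgap a' haC').resolve_left (not_le.2 h)) ?_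
      rintro rfl
      obtain ⟨y, hy, hyI, hne⟩ := hp.exists_mem_Ioo_ne hb h hab'
      rcases hgap y hy with h | h
      · exact absurd hyI.1 (not_lt.2 h)
      · rcases hgap' y hy with h' | h'
        · exact hne (le_antisymm h' h)
        · exact absurd hyI.2 (not_lt.2 h')
    obtain ⟨l, hl, hbl, hla⟩ := hC.exists_mem_leftEnds hd hb haC' hba
    exact ⟨⟨l, hl⟩, show a < l from hab.trans_le hbl, hla⟩⟩
  exact Order.iso_of_countable_dense _ _

/-- Any two nonempty compact, perfect, totally disconnected sets of reals are ambiently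
homeomorphic. -/
theorem Preperfect.exists_homeomorph_image_eq {C D : Set ℝ} (hp : Preperfect C)
    (hC : IsCompact C) (hd : IsTotallyDisconnected C) (hne : C.Nonempty) (hp' : Preperfect D)
    (hD : IsCompact D) (hd' : IsTotallyDisconnected D) (hne' : D.Nonempty) :
    ∃ f : ℝ ≃ₜ ℝ, f '' C = D := by
  obtain ⟨e₁⟩ := hp.nonempty_leftEnds_orderIso_rat hC hd hne
  obtain ⟨e₂⟩ := hp'.nonempty_leftEnds_orderIso_rat hD hd' hne'
  obtain ⟨E₁⟩ := hC.nonempty_orderIso_lowerSet_leftEnds hd hne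
  obtain ⟨E₂⟩ := hD.nonempty_orderIso_lowerSet_leftEnds hd' hne'
  exact hC.exists_homeomorph_image_eq hD
    (E₁.trans ((LowerSet.map (e₁.trans e₂.symm)).trans E₂.symm))

theorem accPt_univ_of_accPt_subtype {X : Set ℝ} {x : X} (h : AccPt (x : ℝ) (𝓟 X)) :
    AccPt x (𝓟 univ) := by
  rw [accPt_iff_nhds] at h ⊢
  intro U hU
  obtain ⟨V, hV, hVU⟩ := (mem_nhds_subtype X x U).1 hU
  obtain ⟨y, hy, hne⟩ := h V hV
  exact ⟨⟨y, hy.2⟩, ⟨hVU hy.1, mem_univ _⟩, fun h => hne (congrArg Subtype.val h)⟩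

/-- A continuous injection sends non-isolated points to non-isolated points of its range. -/
theorem AccPt.range {Z : Type*} [TopologicalSpace Z] {z : Z} (h : AccPt z (𝓟 univ)) {g : Z → ℝ}
    (hg : Continuous g) (hinj : Function.Injective g) : AccPt (g z) (𝓟 (range g)) := by
  simpa using h.map hg.continuousAt hinj

theorem Homeomorph.range_val_comp {Z : Type*} [TopologicalSpace Z] {Y : Set ℝ} (e : Z ≃ₜ Y) :
    range (fun z => (e z : ℝ)) = Y := by
  ext y
  exact ⟨fun ⟨z, hz⟩ => hz ▸ (e z).2, fun hy => ⟨e.symm ⟨y, hy⟩, by simp⟩⟩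

theorem Homeomorph.accPt_coe {X Y : Set ℝ} (φ : X ≃ₜ Y) {x : X} (h : AccPt (x : ℝ) (𝓟 X)) :
    AccPt (φ x : ℝ) (𝓟 Y) := by
  have := (accPt_univ_of_accPt_subtype h).range (g := fun x => (φ x : ℝ))
    (continuous_subtype_val.comp φ.continuous) (Subtype.val_injective.comp φ.injective)
  rwa [φ.range_val_comp] at this

theorem Homeomorph.accPt_coe_iff {X Y : Set ℝ} (φ : X ≃ₜ Y) {x : X} :
    AccPt (φ x : ℝ) (𝓟 Y) ↔ AccPt (x : ℝ) (𝓟 X) :=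
  ⟨fun h => by simpa using φ.symm.accPt_coe h, φ.accPt_coe⟩

theorem accPt_univ_nat_bool (x : ℕ → Bool) : AccPt x (𝓟 univ) := by
  classical
  rw [accPt_principal_iff_nhdsWithin, ← compl_eq_univ_sdiff]
  have h : Tendsto (fun n => Function.update x n (!x n)) atTop (𝓝[≠] x) := by
    refine tendsto_nhdsWithin_iff.2 ⟨tendsto_pi_nhds.2 fun i => ?_, .of_forall fun n h => ?_⟩
    · refine tendsto_const_nhds.congr' ?_
      filter_upwards [eventually_gt_atTop i] with n hn
      simp [Function.update_of_ne hn.ne]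
    · simpa using congrFun h n
  exact h.neBot

/-- The topological properties of a copy of the Cantor set in `ℝ`. -/
theorem Homeomorph.perfect_of_nat_bool {Y : Set ℝ} (e : Y ≃ₜ (ℕ → Bool)) :
    Preperfect Y ∧ IsCompact Y ∧ IsTotallyDisconnected Y ∧ Y.Nonempty := by
  refine ⟨fun y hy => ?_, ?_, ?_, ?_⟩
  · have := (accPt_univ_nat_bool (e ⟨y, hy⟩)).range (g := fun z => (e.symm z : ℝ))
      (continuous_subtype_val.comp e.symm.continuous)
      (Subtype.val_injective.comp e.symm.injective)
    simpa [e.symm.range_val_comp] using this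
  · exact isCompact_iff_compactSpace.2 e.symm.compactSpace
  · exact totallyDisconnectedSpace_subtype_iff.1 e.symm.totallyDisconnectedSpace
  · exact ⟨e.symm fun _ => true, (e.symm fun _ => true).2⟩

/-- Nonempty compact, perfect, totally disconnected sets of reals are copies of the Cantor set. -/
theorem Preperfect.nonempty_homeomorph_nat_bool {X : Set ℝ} (hp : Preperfect X)
    (hX : IsCompact X) (hd : IsTotallyDisconnected X) (hne : X.Nonempty) :
    Nonempty (X ≃ₜ (ℕ → Bool)) := by
  obtain ⟨hp', hC, hd', hne'⟩ := cantorSetHomeomorphNatToBool.perfect_of_nat_bool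
  obtain ⟨f, hf⟩ := hp.exists_homeomorph_image_eq hX hd hne hp' hC hd' hne'
  exact ⟨((f.image X).trans (Homeomorph.setCongr hf)).trans cantorSetHomeomorphNatToBool⟩

theorem Set.Finite.isTame {X : Set ℝ} (hX : X.Finite) : IsTame X := by
  rintro Y ⟨e⟩
  have : Finite X := hX
  have hY : Y.Finite := Finite.of_equiv X e.toEquiv
  have hc : X.ncard = Y.ncard := Nat.card_congr e.toEquiv
  obtain ⟨s, rfl⟩ := hX.exists_finset_coe
  obtain ⟨t, rfl⟩ := hY.exists_finset_coe
  rw [ncard_coe_finset, ncard_coe_finset] at hc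
  exact hX.isCompact.exists_homeomorph_image_eq hY.isCompact
    ((s.orderIsoOfFin hc).symm.trans (t.orderIsoOfFin rfl))

theorem Homeomorph.isTame_of_nat_bool {X : Set ℝ} (e : X ≃ₜ (ℕ → Bool)) : IsTame X := by
  rintro Y ⟨e'⟩
  obtain ⟨hp, hC, hd, hne⟩ := e.perfect_of_nat_bool
  obtain ⟨hp', hC', hd', hne'⟩ := (e'.symm.trans e).perfect_of_nat_bool
  exact hp.exists_homeomorph_image_eq hC hd hne hp' hC' hd' hne'

/-- The point `y` is the least or the greatest element of `A`. -/
def IsMinOrMax (A : Set ℝ) (y : ℝ) : Prop := IsLeast A y ∨ IsGreatest A y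

theorem IsMinOrMax.eq_or_eq {A : Set ℝ} {y a b : ℝ} (h : IsMinOrMax A y) (ha : IsLeast A a)
    (hb : IsGreatest A b) : y = a ∨ y = b :=
  h.imp (fun h => h.unique ha) (fun h => h.unique hb)

theorem IsMinOrMax.image {A : Set ℝ} {y : ℝ} (h : IsMinOrMax A y) (f : ℝ ≃ₜ ℝ) :
    IsMinOrMax (f '' A) (f y) := by
  rcases f.continuous.strictMono_of_inj f.injective with hf | hf
  · exact h.imp hf.monotone.map_isLeast hf.monotone.map_isGreatest
  · exact h.symm.imp hf.antitone.map_isGreatest hf.antitone.map_isLeast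

/-- Copies of a tame set have the same kinds of extreme points. -/
theorem IsTame.exists_isMinOrMax {X Y Z : Set ℝ} (hX : IsTame X) (φ : X ≃ₜ Y) (ψ : X ≃ₜ Z) {y : ℝ}
    (hy : IsMinOrMax Y y) : ∃ z, IsMinOrMax Z z ∧ (AccPt z (𝓟 Z) ↔ AccPt y (𝓟 Y)) := by
  obtain ⟨f, rfl⟩ := hX Y ⟨φ⟩
  obtain ⟨g, rfl⟩ := hX Z ⟨ψ⟩
  set h := f.symm.trans g with hh
  have himg : h '' (f '' X) = g '' X := by
    rw [image_image]
    simp [hh]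
  have hyY : y ∈ f '' X := hy.elim (fun h => h.1) (fun h => h.1)
  refine ⟨h y, himg ▸ hy.image h, ?_⟩
  rw [← himg]
  exact (h.image (f '' X)).accPt_coe_iff (x := ⟨y, hyY⟩)

/-- Moving finitely many isolated points does not destroy continuity. -/
theorem continuous_of_eq_coe_off_isolated {X : Set ℝ} {g : X → ℝ} {S : Set X} (hS : S.Finite)
    (hiso : ∀ x ∈ S, ¬ AccPt (x : ℝ) (𝓟 X)) (hg : ∀ x ∉ S, g x = x) : Continuous g := by
  refine continuous_iff_continuousAt.2 fun x => ?_
  by_cases hx : x ∈ S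
  · have h : ¬ (𝓝[≠] x).NeBot := fun h => hiso x hx <| by
      have h' : AccPt x (𝓟 univ) := by
        rwa [accPt_principal_iff_nhdsWithin, ← compl_eq_univ_sdiff]
      simpa using h'.range continuous_subtype_val Subtype.val_injective
    have hopen : IsOpen {x} := (isOpen_singleton_iff_punctured_nhds x).2 (not_neBot.1 h)
    rw [ContinuousAt, (isOpen_singleton_iff_nhds_eq_pure x).1 hopen]
    exact tendsto_pure_nhds g x
  · refine continuous_subtype_val.continuousAt.congr ?_
    filter_upwards [hS.isClosed.isOpen_compl.mem_nhds hx] with y hy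
    exact (hg y hy).symm

/-- A totally disconnected set of reals maps injectively and continuously to `ℝ` with a prescribed
least point. -/
theorem IsTotallyDisconnected.exists_continuous_injective_least {X : Set ℝ}
    (hd : IsTotallyDisconnected X) (q : X) : ∃ g : X → ℝ, Continuous g ∧ Function.Injective g ∧ ∀ x, g q ≤ g x := by
  obtain ⟨z, -, hz⟩ := hd.exists_notMem_Ioo zero_lt_one
  have : Nonempty ↥Xᶜ := ⟨⟨z, hz⟩⟩
  obtain ⟨d, hdense⟩ := TopologicalSpace.exists_dense_seq ↥Xᶜ
  let b : X → ℕ → Bool := fun x n => decide ((x : ℝ) < d n)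
  have hb : Continuous b := continuous_pi fun n => by
    refine (IsLocallyConstant.iff_eventually_eq _).2 (fun x => ?_) |>.continuous
    have hne : (x : ℝ) ≠ d n := fun h => (d n).2 (h ▸ x.2)
    rcases lt_or_gt_of_ne hne with h | h
    · filter_upwards [continuous_subtype_val.continuousAt.eventually_lt_const h] with y hy
      simp [b, h, hy]
    · filter_upwards [continuous_subtype_val.continuousAt.eventually_const_lt h] with y hy
      simp [b, not_lt.2 h.le, not_lt.2 (le_of_lt hy)]
  have hbinj : Function.Injective b := by
    have key : ∀ x y : X, (x : ℝ) < y → b x ≠ b y := fun x y hxy h => by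
      obtain ⟨w, hw, hwX⟩ := hd.exists_notMem_Ioo hxy
      obtain ⟨n, hn⟩ := hdense.exists_mem_open
        (isOpen_Ioo.preimage continuous_subtype_val : IsOpen ((↑) ⁻¹' Ioo (x : ℝ) y : Set ↥Xᶜ))
        ⟨⟨w, hwX⟩, hw⟩
      have := congrFun h n
      simp [b, hn.1, not_lt.2 (le_of_lt hn.2)] at this
    intro x y h
    rcases lt_trichotomy (x : ℝ) y with hxy | hxy | hxy
    · exact absurd h (key x y hxy)
    · exact Subtype.ext hxy
    · exact absurd h.symm (key y x hxy)
  have hcont : Continuous (Cardinal.cantorFunction (1 / 3)) := by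
    refine continuous_tsum (u := fun n => (1 / 3 : ℝ) ^ n) (fun n => ?_)
      (summable_geometric_of_lt_one (by norm_num) (by norm_num)) fun n f => ?_
    · exact (continuous_of_discreteTopology (f := fun t : Bool => cond t ((1 / 3 : ℝ) ^ n) 0)).comp
        (continuous_apply n)
    · cases h : f n <;> simp [Cardinal.cantorFunctionAux, h]
  refine ⟨fun x => Cardinal.cantorFunction (1 / 3) fun n => xor (b x n) (b q n), ?_, ?_, ?_⟩
  · refine hcont.comp (continuous_pi fun n => ?_)
    exact (continuous_of_discreteTopology (f := fun t : Bool => xor t (b q n))).comp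
      ((continuous_apply n).comp hb)
  · intro x y h
    have h' := Cardinal.cantorFunction_injective (by norm_num) (by norm_num) h
    exact hbinj (funext fun n => by simpa using congrFun h' n)
  · intro x
    exact Cardinal.cantorFunction_le (by norm_num) (by norm_num) fun n => by simp

theorem Continuous.exists_homeomorph_range {X : Set ℝ} (hX : IsCompact X) {g : X → ℝ}
    (hg : Continuous g) (hinj : Function.Injective g) :
    ∃ φ : X ≃ₜ range g, ∀ x, (φ x : ℝ) = g x := by
  have : CompactSpace X := isCompact_iff_compactSpace.1 hX
  exact ⟨(hg.isClosedEmbedding hinj).isEmbedding.toHomeomorph, fun x => rfl⟩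

/-- If `X` has two isolated points, one copy of `X` has both extreme points isolated and another
has a non-isolated one; if it has exactly one, some copy has an isolated extreme point and another
has none. -/
theorem IsTame.preperfect_of_infinite {X : Set ℝ} (ht : IsTame X) (hX : IsCompact X)
    (hd : IsTotallyDisconnected X) (hinf : X.Infinite) : Preperfect X := by
  classical
  by_contra hnp
  obtain ⟨p, hp, hpiso⟩ : ∃ p ∈ X, ¬ AccPt p (𝓟 X) := by simpa [Preperfect] using hnp
  obtain ⟨m, hm⟩ := hX.exists_isLeast ⟨p, hp⟩
  obtain ⟨M, hM⟩ := hX.exists_isGreatest ⟨p, hp⟩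
  by_cases h2 : ∃ p' ∈ X, p' ≠ p ∧ ¬ AccPt p' (𝓟 X)
  · obtain ⟨p', hp', hne, hpiso'⟩ := h2
    let g : X → ℝ := fun x => if (x : ℝ) = p then m - 1 else if (x : ℝ) = p' then M + 1 else x
    have hgp : g ⟨p, hp⟩ = m - 1 := by simp [g]
    have hgp' : g ⟨p', hp'⟩ = M + 1 := by simp [g, hne]
    have hb : ∀ x : X, m ≤ x ∧ (x : ℝ) ≤ M := fun x => ⟨hm.2 x.2, hM.2 x.2⟩
    have hg : Continuous g := by
      refine continuous_of_eq_coe_off_isolated (S := {⟨p, hp⟩, ⟨p', hp'⟩}) (toFinite _) ?_ ?_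
      · rintro x (rfl | rfl)
        · exact hpiso
        · exact hpiso'
      · intro x hx
        simp only [mem_insert_iff, mem_singleton_iff, not_or, Subtype.ext_iff] at hx
        simp [g, hx.1, hx.2]
    have hinj : Function.Injective g := fun x y hxy => by
      have := hb x
      have := hb y
      refine Subtype.ext ?_
      simp only [g] at hxy
      split_ifs at hxy <;> linarith
    obtain ⟨φ, hφ⟩ := hg.exists_homeomorph_range hX hinj
    have hleast : IsLeast (range g) (m - 1) := ⟨⟨_, hgp⟩, by
      rintro _ ⟨x, rfl⟩
      have := hb x
      simp only [g]
      split_ifs <;> linarith⟩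
    have hgreatest : IsGreatest (range g) (M + 1) := ⟨⟨_, hgp'⟩, by
      rintro _ ⟨x, rfl⟩
      have := hb x
      simp only [g]
      split_ifs <;> linarith⟩
    obtain ⟨q, hq, hqacc⟩ := hinf.exists_accPt_of_subset_isCompact hX Subset.rfl
    obtain ⟨k, hk, hkinj, hkq⟩ := hd.exists_continuous_injective_least ⟨q, hq⟩
    obtain ⟨ψ, hψ⟩ := hk.exists_homeomorph_range hX hkinj
    have hext : IsMinOrMax (range k) (k ⟨q, hq⟩) :=
      Or.inl ⟨mem_range_self _, by rintro _ ⟨x, rfl⟩; exact hkq x⟩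
    obtain ⟨z, hz, hzacc⟩ := ht.exists_isMinOrMax ψ φ hext
    have hz' : AccPt z (𝓟 (range g)) := hzacc.2 (by rw [← hψ]; exact ψ.accPt_coe hqacc)
    rcases hz.eq_or_eq hleast hgreatest with rfl | rfl
    · rw [← hgp, ← hφ, φ.accPt_coe_iff] at hz'
      exact hpiso hz'
    · rw [← hgp', ← hφ, φ.accPt_coe_iff] at hz'
      exact hpiso' hz'
  · push Not at h2
    have move : ∀ z : ℝ, z ∉ X → ∃ φ : X ≃ₜ ↥(insert z (X \ {p})), (φ ⟨p, hp⟩ : ℝ) = z ∧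
        ∀ x : X, (x : ℝ) ≠ p → (φ x : ℝ) = x := fun z hz => by
      let g : X → ℝ := fun x => if (x : ℝ) = p then z else x
      have hg : Continuous g := by
        refine continuous_of_eq_coe_off_isolated (S := {⟨p, hp⟩}) (toFinite _) ?_ ?_
        · rintro x rfl
          exact hpiso
        · intro x hx
          simp only [mem_singleton_iff, Subtype.ext_iff] at hx
          simp [g, hx]
      have hinj : Function.Injective g := fun x y hxy => by
        refine Subtype.ext ?_
        simp only [g] at hxy
        split_ifs at hxy with h h' h'
        · rw [h, h']
        · exact absurd y.2 (hxy ▸ hz)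
        · exact absurd x.2 (hxy ▸ hz)
        · exact hxy
      obtain ⟨φ, hφ⟩ := hg.exists_homeomorph_range hX hinj
      have hrange : range g = insert z (X \ {p}) := by
        ext y
        constructor
        · rintro ⟨x, rfl⟩
          by_cases hx : (x : ℝ) = p
          · simp [g, hx]
          · simp [g, hx]
        · rintro (rfl | ⟨hy, hyp⟩)
          · exact ⟨⟨p, hp⟩, by simp [g]⟩
          · exact ⟨⟨y, hy⟩, if_neg hyp⟩
      refine ⟨φ.trans (Homeomorph.setCongr hrange), ?_, fun x hx => ?_⟩
      · exact (hφ _).trans (if_pos rfl)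
      · exact (hφ _).trans (if_neg hx)
    obtain ⟨φ, hφp, -⟩ := move (M + 1) fun h => by linarith [hM.2 h]
    have hext : IsMinOrMax (insert (M + 1) (X \ {p})) (M + 1) :=
      Or.inr ⟨mem_insert _ _, by
        rintro y (rfl | hy)
        · exact le_rfl
        · linarith [hM.2 hy.1]⟩
    have hiso : ¬ AccPt (M + 1) (𝓟 (insert (M + 1) (X \ {p}))) := fun h => by
      have h' : AccPt (φ ⟨p, hp⟩ : ℝ) (𝓟 (insert (M + 1) (X \ {p}))) := by rwa [hφp]
      exact hpiso (φ.accPt_coe_iff.1 h')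
    have hclosed : IsClosed (X \ {p}) := isClosed_iff_accPt.2 fun a ha => by
      have ha' : AccPt a (𝓟 X) := ha.mono (principal_mono.2 sdiff_subset)
      exact ⟨isClosed_iff_accPt.1 hX.isClosed a ha', by rintro rfl; exact hpiso ha'⟩
    have hcomp : IsCompact (X \ {p}) := hX.of_isClosed_subset hclosed sdiff_subset
    have hinf' : (X \ {p}).Infinite := hinf.sdiff (finite_singleton p)
    obtain ⟨m', hm'⟩ := hcomp.exists_isLeast hinf'.nonempty
    obtain ⟨M', hM'⟩ := hcomp.exists_isGreatest hinf'.nonempty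
    have hlt : m' < M' := by
      obtain ⟨x, hx, y, hy, hxy⟩ := hinf'.nontrivial
      by_contra! h
      exact hxy (by linarith [hm'.2 hx, hm'.2 hy, hM'.2 hx, hM'.2 hy])
    obtain ⟨z, hz, hzX⟩ := hd.exists_notMem_Ioo hlt
    obtain ⟨ψ, -, hψ⟩ := move z hzX
    have hleast : IsLeast (insert z (X \ {p})) m' := ⟨Or.inr hm'.1, by
      rintro y (rfl | hy)
      · exact hz.1.le
      · exact hm'.2 hy⟩
    have hgreatest : IsGreatest (insert z (X \ {p})) M' := ⟨Or.inr hM'.1, by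
      rintro y (rfl | hy)
      · exact hz.2.le
      · exact hM'.2 hy⟩
    have hacc : ∀ x ∈ X \ {p}, AccPt x (𝓟 (insert z (X \ {p}))) := fun x hx => by
      have := ψ.accPt_coe (x := ⟨x, hx.1⟩) (h2 x hx.1 hx.2)
      rwa [hψ ⟨x, hx.1⟩ hx.2] at this
    obtain ⟨w, hw, hwacc⟩ := ht.exists_isMinOrMax φ ψ hext
    refine hiso (hwacc.1 ?_)
    rcases hw.eq_or_eq hleast hgreatest with rfl | rfl
    · exact hacc _ hm'.1
    · exact hacc _ hM'.1

theorem tame_iff_finite_or_cantor (X : Set ℝ) (hX : IsCompact X)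
    (htriv : ∀ x ∈ X, connectedComponentIn X x = {x}) :
    IsTame X ↔ X.Finite ∨ Nonempty (↥X ≃ₜ (ℕ → Bool)) := by
  have hd : IsTotallyDisconnected X := fun t htX ht x hx y hy => by
    have := ht.subset_connectedComponentIn hx htX hy
    rw [htriv x (htX hx)] at this
    exact (mem_singleton_iff.1 this).symm
  constructor
  · intro ht
    refine or_iff_not_imp_left.2 fun hinf => ?_
    exact (ht.preperfect_of_infinite hX hd hinf).nonempty_homeomorph_nat_bool hX hd
      (Set.Infinite.nonempty hinf)
  · rintro (hfin | ⟨⟨e⟩⟩)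
    · exact hfin.isTame
    · exact e.isTame_of_nat_bool
end

section
/- There exist uncountably many (at least ℵ₁) pairwise non-homeomorphic regularly closed compact tame subsets of ℝ. Specifically, there is a family {X_α : α < ω₁} of regularly closed compact subsets of ℝ such that for β < α, the β-th Cantor–Bendixson derivative of the ordered family of X_β-intervals is a singleton while the β-th derivative of the family of X_α-intervals is infinite, so X_β and X_α are not homeomorphic. -/
open Set

section RankedSets

open Topology

variable {W : Type*} [LinearOrder W]

/-- `p ∈ X` is a left end point of a component of `X` near which, on the left, the values of `ρ` on
`X` are smaller than `ρ p` and cofinal in the values below `ρ p`. -/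
structure LeftEnd (X : Set ℝ) (ρ : ℝ → W) (p : ℝ) : Prop where
  gap : ∀ z < p, ∃ y ∉ X, z < y ∧ y < p
  drop : ∃ z < p, ∀ y ∈ X, z < y → y < p → ρ y < ρ p
  reach : ∀ γ < ρ p, ∀ z < p, ∃ y ∈ X, z < y ∧ y < p ∧ γ ≤ ρ y

/-- `[p, q]` is a component of `X` on which `ρ` is constant, with the same Cantor–Bendixson type of
accumulation, recorded by `ρ`, at both end points. -/
structure RankedComponent (X : Set ℝ) (ρ : ℝ → W) (p q : ℝ) : Prop where
  lt : p < q
  subset : Icc p q ⊆ X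
  const : ∀ x ∈ Icc p q, ρ x = ρ p
  left_end : LeftEnd X ρ p
  right_end : LeftEnd (-X) (fun x => ρ (-x)) (-q)

/-- `X` is compact and all its components are ranked by `ρ`. -/
structure Ranked (X : Set ℝ) (ρ : ℝ → W) : Prop where
  isCompact : IsCompact X
  exists_component : ∀ x ∈ X, ∃ p q, x ∈ Icc p q ∧ RankedComponent X ρ p q

/-- The maximal value of `ρ` on `X` is `α`, attained on the single component `[p, q]`. -/
structure HasTop (X : Set ℝ) (ρ : ℝ → W) (α : W) (p q : ℝ) : Prop where
  component : RankedComponent X ρ p q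
  rank_eq : ρ p = α
  rank_lt : ∀ y ∈ X, y ∉ Icc p q → ρ y < α

theorem LeftEnd.congr {X X' : Set ℝ} {ρ ρ' : ℝ → W} {p u v : ℝ} (h : LeftEnd X ρ p)
    (hp : p ∈ Ioo u v) (hX : ∀ x ∈ Ioo u v, x ∈ X' ↔ x ∈ X)
    (hρ : ∀ x ∈ X, x ∈ Ioo u v → ρ' x = ρ x) (hpX : p ∈ X) : LeftEnd X' ρ' p := by
  obtain ⟨hu, hv⟩ := hp
  refine ⟨fun z hz => ?_, ?_, fun γ hγ z hz => ?_⟩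
  · obtain ⟨y, hy, h1, h2⟩ := h.gap (max z u) (max_lt hz hu)
    rw [max_lt_iff] at h1
    exact ⟨y, fun hy' => hy ((hX y ⟨h1.2, h2.trans hv⟩).1 hy'), h1.1, h2⟩
  · obtain ⟨z, hz, hd⟩ := h.drop
    refine ⟨max z u, max_lt hz hu, fun y hy h1 h2 => ?_⟩
    rw [max_lt_iff] at h1
    have hyI : y ∈ Ioo u v := ⟨h1.2, h2.trans hv⟩
    have hy' := (hX y hyI).1 hy
    rw [hρ y hy' hyI, hρ p hpX ⟨hu, hv⟩]
    exact hd y hy' h1.1 h2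
  · rw [hρ p hpX ⟨hu, hv⟩] at hγ
    obtain ⟨y, hy, h1, h2, h3⟩ := h.reach γ hγ (max z u) (max_lt hz hu)
    rw [max_lt_iff] at h1
    have hyI : y ∈ Ioo u v := ⟨h1.2, h2.trans hv⟩
    exact ⟨y, (hX y hyI).2 hy, h1.1, h2, by rwa [hρ y hy hyI]⟩

namespace RankedComponent

variable {X Y : Set ℝ} {ρ σ : ℝ → W} {p q : ℝ}

theorem left_mem (h : RankedComponent X ρ p q) : p ∈ X := h.subset ⟨le_rfl, h.lt.le⟩

theorem right_mem (h : RankedComponent X ρ p q) : q ∈ X := h.subset ⟨h.lt.le, le_rfl⟩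

theorem rank_right (h : RankedComponent X ρ p q) : ρ q = ρ p := h.const q ⟨h.lt.le, le_rfl⟩

theorem neg (h : RankedComponent X ρ p q) :
    RankedComponent (-X) (fun x => ρ (-x)) (-q) (-p) where
  lt := neg_lt_neg h.lt
  subset x hx := h.subset ⟨by linarith [hx.2], by linarith [hx.1]⟩
  const x hx := by
    rw [neg_neg, h.rank_right]
    exact h.const _ ⟨by linarith [hx.2], by linarith [hx.1]⟩
  left_end := h.right_end
  right_end := by simpa using h.left_end

theorem congr {X' : Set ℝ} {ρ' : ℝ → W} {u v : ℝ} (h : RankedComponent X ρ p q)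
    (hpq : Icc p q ⊆ Ioo u v) (hX : ∀ x ∈ Ioo u v, x ∈ X' ↔ x ∈ X)
    (hρ : ∀ x ∈ X, x ∈ Ioo u v → ρ' x = ρ x) : RankedComponent X' ρ' p q := by
  have hp := hpq ⟨le_rfl, h.lt.le⟩
  have hq := hpq ⟨h.lt.le, le_rfl⟩
  refine ⟨h.lt, fun x hx => (hX x (hpq hx)).2 (h.subset hx), fun x hx => ?_,
    h.left_end.congr hp hX hρ h.left_mem, ?_⟩
  · rw [hρ x (h.subset hx) (hpq hx), hρ p h.left_mem hp, h.const x hx]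
  · refine h.right_end.congr (u := -v) (v := -u) ⟨neg_lt_neg hq.2, neg_lt_neg hq.1⟩
      (fun x hx => hX (-x) ⟨by linarith [hx.2], by linarith [hx.1]⟩)
      (fun x hx hxI => hρ (-x) hx ⟨by linarith [hxI.2], by linarith [hxI.1]⟩) ?_
    simpa using h.right_mem

theorem gap_right (h : RankedComponent X ρ p q) (z : ℝ) (hz : q < z) :
    ∃ y ∉ X, q < y ∧ y < z := by
  obtain ⟨y, hy, h1, h2⟩ := h.right_end.gap (-z) (neg_lt_neg hz)
  exact ⟨-y, hy, by linarith, by linarith⟩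

theorem drop_right (h : RankedComponent X ρ p q) :
    ∃ z > q, ∀ y ∈ X, q < y → y < z → ρ y < ρ p := by
  obtain ⟨z, hz, hd⟩ := h.right_end.drop
  refine ⟨-z, by linarith, fun y hy h1 h2 => ?_⟩
  have := hd (-y) (by simpa using hy) (by linarith) (by linarith)
  simpa [h.rank_right] using this

theorem subset_of_isPreconnected (h : RankedComponent X ρ p q) {S : Set ℝ}
    (hS : IsPreconnected S) (hSX : S ⊆ X) {x : ℝ} (hxS : x ∈ S) (hx : x ∈ Icc p q) :
    S ⊆ Icc p q := by
  intro y hy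
  by_contra hcon
  rcases lt_or_ge y p with hyp | hyp
  · obtain ⟨w, hw, h1, h2⟩ := h.left_end.gap y hyp
    exact hw (hSX (hS.ordConnected.out hy hxS ⟨h1.le, h2.le.trans hx.1⟩))
  · have hyq : q < y := not_le.1 fun hh => hcon ⟨hyp, hh⟩
    obtain ⟨w, hw, h1, h2⟩ := h.gap_right y hyq
    exact hw (hSX (hS.ordConnected.out hxS hy ⟨hx.2.trans h1.le, h2.le⟩))

theorem eq_of_mem (h : RankedComponent X ρ p q) {p' q' x : ℝ}
    (h' : RankedComponent X σ p' q') (hx : x ∈ Icc p q) (hx' : x ∈ Icc p' q') :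
    p = p' ∧ q = q' := by
  have h1 := h.subset_of_isPreconnected isPreconnected_Icc h'.subset hx' hx
  have h2 := h'.subset_of_isPreconnected isPreconnected_Icc h.subset hx hx'
  rw [Icc_subset_Icc_iff h'.lt.le] at h1
  rw [Icc_subset_Icc_iff h.lt.le] at h2
  exact ⟨le_antisymm h1.1 h2.1, le_antisymm h2.2 h1.2⟩

end RankedComponent

/-- Mutually inverse continuous maps between subsets of the line. -/
structure InverseMaps (X Y : Set ℝ) (f g : ℝ → ℝ) : Prop where
  continuousOn : ContinuousOn f X
  continuousOn_inv : ContinuousOn g Y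
  mapsTo : MapsTo f X Y
  mapsTo_inv : MapsTo g Y X
  left_inv : LeftInvOn g f X
  right_inv : LeftInvOn f g Y

theorem exists_inverseMaps {X Y : Set ℝ} (h : X ≃ₜ Y) : ∃ f g, InverseMaps X Y f g := by
  classical
  refine ⟨fun x => if hx : x ∈ X then h ⟨x, hx⟩ else 0,
    fun y => if hy : y ∈ Y then h.symm ⟨y, hy⟩ else 0, ?_, ?_, ?_, ?_, ?_, ?_⟩
  · rw [continuousOn_iff_continuous_domRestrict]
    convert continuous_subtype_val.comp h.continuous using 1
    ext x
    simp
  · rw [continuousOn_iff_continuous_domRestrict]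
    convert continuous_subtype_val.comp h.symm.continuous using 1
    ext x
    simp
  · intro x hx
    simp [hx]
  · intro x hx
    simp [hx]
  · intro x hx
    simp [hx]
  · intro x hx
    simp [hx]

theorem InverseMaps.comp_neg {X Y : Set ℝ} {f g : ℝ → ℝ} (h : InverseMaps X Y f g) :
    InverseMaps X (-Y) (fun x => -f x) (fun y => g (-y)) where
  continuousOn := h.continuousOn.neg
  continuousOn_inv := h.continuousOn_inv.comp continuousOn_neg fun _ hy => hy
  mapsTo x hx := by simpa using h.mapsTo hx
  mapsTo_inv x hx := h.mapsTo_inv hx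
  left_inv x hx := by simpa using h.left_inv hx
  right_inv x hx := by
    have := h.right_inv (mem_neg.1 hx)
    simp [this]

theorem InverseMaps.neg_comp {X Y : Set ℝ} {f g : ℝ → ℝ} (h : InverseMaps X Y f g) :
    InverseMaps (-X) Y (fun x => f (-x)) (fun y => -g y) where
  continuousOn := h.continuousOn.comp continuousOn_neg fun _ hy => hy
  continuousOn_inv := h.continuousOn_inv.neg
  mapsTo x hx := h.mapsTo hx
  mapsTo_inv x hx := by simpa using h.mapsTo_inv hx
  left_inv x hx := by
    have := h.left_inv (mem_neg.1 hx)
    simp [this]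
  right_inv x hx := by simpa using h.right_inv hx

theorem exists_lt_forall_of_continuousOn {X : Set ℝ} {f : ℝ → ℝ} (hf : ContinuousOn f X) {p : ℝ}
    (hp : p ∈ X) {a b : ℝ} (ha : a < f p) (hb : f p < b) :
    ∃ z < p, ∀ x ∈ X, z < x → x < p → f x ∈ Ioo a b := by
  have h1 := hf p hp (Ioo_mem_nhds ha hb)
  rw [Filter.mem_map, mem_nhdsWithin_iff_exists_mem_nhds_inter] at h1
  obtain ⟨U, hU, hUX⟩ := h1
  obtain ⟨l, hl, hlU⟩ := exists_Ioc_subset_of_mem_nhds hU ⟨p - 1, by linarith⟩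
  exact ⟨l, hl, fun x hx h2 h3 => hUX ⟨hlU ⟨h2, h3.le⟩, hx⟩⟩

section Transport

variable {X Y : Set ℝ} {ρ : ℝ → W} {f g : ℝ → ℝ} {p q : ℝ}

theorem InverseMaps.image_Icc (h : InverseMaps X Y f g) (hpq : p ≤ q) (hX : Icc p q ⊆ X)
    (hmono : StrictMonoOn f (Icc p q)) : f '' Icc p q = Icc (f p) (f q) := by
  refine Subset.antisymm ?_ ?_
  · rintro _ ⟨x, hx, rfl⟩
    exact ⟨hmono.monotoneOn ⟨le_rfl, hpq⟩ hx hx.1, hmono.monotoneOn hx ⟨hpq, le_rfl⟩ hx.2⟩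
  · exact (h.continuousOn.mono hX).surjOn_Icc ⟨le_rfl, hpq⟩ ⟨hpq, le_rfl⟩

theorem InverseMaps.mem_Icc_iff (h : InverseMaps X Y f g) (hpq : p ≤ q) (hX : Icc p q ⊆ X)
    (hmono : StrictMonoOn f (Icc p q)) {x : ℝ} (hx : x ∈ X) :
    f x ∈ Icc (f p) (f q) ↔ x ∈ Icc p q := by
  rw [← h.image_Icc hpq hX hmono]
  refine ⟨?_, fun hx => ⟨x, hx, rfl⟩⟩
  rintro ⟨y, hy, hyx⟩
  rwa [← h.left_inv.injOn (hX hy) hx hyx]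

theorem InverseMaps.inv_mem_Icc_iff (h : InverseMaps X Y f g) (hpq : p ≤ q) (hX : Icc p q ⊆ X)
    (hmono : StrictMonoOn f (Icc p q)) {y : ℝ} (hy : y ∈ Y) :
    g y ∈ Icc p q ↔ y ∈ Icc (f p) (f q) := by
  rw [← h.mem_Icc_iff hpq hX hmono (h.mapsTo_inv hy), h.right_inv hy]

theorem RankedComponent.leftEnd_map (hc : RankedComponent X ρ p q) (h : InverseMaps X Y f g)
    (hmono : StrictMonoOn f (Icc p q)) : LeftEnd Y (fun y => ρ (g y)) (f p) := by
  have hmem : ∀ {x}, x ∈ X → (f x ∈ Icc (f p) (f q) ↔ x ∈ Icc p q) :=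
    h.mem_Icc_iff hc.lt.le hc.subset hmono
  have hmem' : ∀ {y}, y ∈ Y → (g y ∈ Icc p q ↔ y ∈ Icc (f p) (f q)) :=
    h.inv_mem_Icc_iff hc.lt.le hc.subset hmono
  have hlt : f p < f q := hmono ⟨le_rfl, hc.lt.le⟩ ⟨hc.lt.le, le_rfl⟩ hc.lt
  have hgp : g (f p) = p := h.left_inv hc.left_mem
  refine ⟨fun z hz => ?_, ?_, fun γ hγ z hz => ?_⟩
  · by_contra! hcon
    obtain ⟨w, hzw, hwp⟩ := exists_between hz
    have hwY : Icc w (f p) ⊆ Y := fun y hy => by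
      rcases hy.2.eq_or_lt with rfl | hlt'
      · exact h.mapsTo hc.left_mem
      · by_contra hyY
        exact absurd (hcon y hyY (hzw.trans_le hy.1)) (not_le.2 hlt')
    have hsub := hc.subset_of_isPreconnected
      (isPreconnected_Icc.image g (h.continuousOn_inv.mono hwY))
      (image_subset_iff.2 fun y hy => h.mapsTo_inv (hwY hy)) (x := p)
      ⟨f p, ⟨hwp.le, le_rfl⟩, hgp⟩ ⟨le_rfl, hc.lt.le⟩
    have hw := hsub ⟨w, ⟨le_rfl, hwp.le⟩, rfl⟩
    exact absurd ((hmem' (hwY ⟨le_rfl, hwp.le⟩)).1 hw).1 (not_le.2 hwp)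
  · obtain ⟨z, hz, hd⟩ := hc.left_end.drop
    obtain ⟨z', hz', hg⟩ := exists_lt_forall_of_continuousOn h.continuousOn_inv
      (h.mapsTo hc.left_mem) (a := z) (b := q) (by rwa [hgp]) (by rw [hgp]; exact hc.lt)
    refine ⟨z', hz', fun y hy h1 h2 => ?_⟩
    have h3 := hg y hy h1 h2
    have h4 : g y < p := by
      by_contra! hcon
      exact absurd ((hmem' hy).1 ⟨hcon, h3.2.le⟩).1 (not_le.2 h2)
    simp only [hgp]
    exact hd _ (h.mapsTo_inv hy) h3.1 h4
  · simp only [hgp] at hγ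
    obtain ⟨z', hz', hf⟩ := exists_lt_forall_of_continuousOn h.continuousOn hc.left_mem hz hlt
    obtain ⟨x, hx, h1, h2, h3⟩ := hc.left_end.reach γ hγ z' hz'
    have h4 := hf x hx h1 h2
    refine ⟨f x, h.mapsTo hx, h4.1, ?_, by rwa [h.left_inv hx]⟩
    by_contra! hcon
    exact absurd ((hmem hx).1 ⟨hcon, h4.2.le⟩).1 (not_le.2 h2)

theorem RankedComponent.map_of_strictMonoOn (hc : RankedComponent X ρ p q)
    (h : InverseMaps X Y f g) (hmono : StrictMonoOn f (Icc p q)) :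
    RankedComponent Y (fun y => ρ (g y)) (f p) (f q) where
  lt := hmono ⟨le_rfl, hc.lt.le⟩ ⟨hc.lt.le, le_rfl⟩ hc.lt
  subset := by
    rw [← h.image_Icc hc.lt.le hc.subset hmono]
    exact image_subset_iff.2 fun x hx => h.mapsTo (hc.subset hx)
  const y hy := by
    rw [← h.image_Icc hc.lt.le hc.subset hmono] at hy
    obtain ⟨x, hx, rfl⟩ := hy
    rw [h.left_inv (hc.subset hx), h.left_inv hc.left_mem, hc.const x hx]
  left_end := hc.leftEnd_map h hmono
  right_end := by
    have := hc.neg.leftEnd_map h.neg_comp.comp_neg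
      (fun x hx y hy hxy => neg_lt_neg (hmono ⟨by linarith [hy.2], by linarith [hy.1]⟩
        ⟨by linarith [hx.2], by linarith [hx.1]⟩ (neg_lt_neg hxy)))
    simpa using this

theorem RankedComponent.map (hc : RankedComponent X ρ p q) (h : InverseMaps X Y f g) :
    ∃ p' q', f '' Icc p q = Icc p' q' ∧ RankedComponent Y (fun y => ρ (g y)) p' q' := by
  rcases ContinuousOn.strictMonoOn_of_injOn_Icc' hc.lt.le (h.continuousOn.mono hc.subset)
    (h.left_inv.injOn.mono hc.subset) with hmono | hanti
  · exact ⟨_, _, h.image_Icc hc.lt.le hc.subset hmono, hc.map_of_strictMonoOn h hmono⟩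
  · have hmono : StrictMonoOn (fun x => -f x) (Icc p q) := hanti.neg
    refine ⟨f q, f p, ?_, by simpa using (hc.map_of_strictMonoOn h.comp_neg hmono).neg⟩
    have h1 := congrArg (Neg.neg '' ·) (h.comp_neg.image_Icc hc.lt.le hc.subset hmono)
    simpa [image_image] using h1

end Transport

/-- The set `X` has a rank function whose maximal value is `α`, attained on one component. -/
def HasRank (X : Set ℝ) (α : W) : Prop :=
  ∃ ρ : ℝ → W, Ranked X ρ ∧ ∃ p q, HasTop X ρ α p q

theorem HasRank.of_homeomorph {X Y : Set ℝ} {α : W} (hX : HasRank X α) (e : X ≃ₜ Y) :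
    HasRank Y α := by
  obtain ⟨ρ, hρ, p, q, htop⟩ := hX
  obtain ⟨f, g, h⟩ := exists_inverseMaps e
  refine ⟨fun y => ρ (g y), ⟨?_, fun y hy => ?_⟩, ?_⟩
  · have : Y = f '' X := by
      refine Subset.antisymm (fun y hy => ⟨g y, h.mapsTo_inv hy, h.right_inv hy⟩) ?_
      exact image_subset_iff.2 h.mapsTo
    rw [this]
    exact hρ.isCompact.image_of_continuousOn h.continuousOn
  · obtain ⟨a, b, hab, hc⟩ := hρ.exists_component (g y) (h.mapsTo_inv hy)
    obtain ⟨a', b', himg, hc'⟩ := hc.map h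
    exact ⟨a', b', himg ▸ ⟨g y, hab, h.right_inv hy⟩, hc'⟩
  · obtain ⟨p', q', himg, hc'⟩ := htop.component.map h
    refine ⟨p', q', hc', ?_, fun y hy hyn => ?_⟩
    · have hp' : p' ∈ f '' Icc p q := himg ▸ ⟨le_rfl, hc'.lt.le⟩
      obtain ⟨x, hx, rfl⟩ := hp'
      rw [h.left_inv (htop.component.subset hx), htop.component.const x hx, htop.rank_eq]
    · refine htop.rank_lt _ (h.mapsTo_inv hy) fun hg => hyn ?_
      rw [← himg]
      exact ⟨_, hg, h.right_inv hy⟩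

theorem Ranked.le_rank [WellFoundedLT W] {X : Set ℝ} {ρ σ : ℝ → W} (hρ : Ranked X ρ)
    (hσ : Ranked X σ) (x : ℝ) (hx : x ∈ X) : σ x ≤ ρ x := by
  induction h : ρ x using WellFoundedLT.induction generalizing x with
  | ind α ih =>
    obtain ⟨p, q, hxp, hc⟩ := hρ.exists_component x hx
    obtain ⟨p', q', hxp', hc'⟩ := hσ.exists_component x hx
    obtain ⟨rfl, rfl⟩ := hc.eq_of_mem hc' hxp hxp'
    rw [hc.const x hxp] at h
    rw [hc'.const x hxp']
    by_contra! hcon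
    obtain ⟨z, hz, hd⟩ := hc.left_end.drop
    obtain ⟨y, hy, h1, h2, h3⟩ := hc'.left_end.reach α hcon z hz
    have h4 := hd y hy h1 h2
    rw [h] at h4
    exact absurd (h3.trans (ih _ h4 y hy rfl)) (not_le.2 h4)

theorem HasRank.unique [WellFoundedLT W] {X : Set ℝ} {α β : W} (hα : HasRank X α)
    (hβ : HasRank X β) : α = β := by
  have key : ∀ {α β : W}, HasRank X α → HasRank X β → α ≤ β := by
    rintro α β ⟨ρ, hρ, p, q, ht⟩ ⟨σ, hσ, p', q', ht'⟩
    have h1 : ρ p ≤ σ p := hσ.le_rank hρ p ht.component.left_mem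
    rw [← ht.rank_eq]
    refine h1.trans ?_
    by_cases hp : p ∈ Icc p' q'
    · rw [ht'.component.const p hp, ht'.rank_eq]
    · exact (ht'.rank_lt p ht.component.left_mem hp).le
  exact le_antisymm (key hα hβ) (key hβ hα)

/-- An increasing bijection of `A` onto `B` takes `X ∩ A` onto `Y ∩ B`. -/
def Matches (X Y A B : Set ℝ) : Prop :=
  ∃ f : ℝ → ℝ, StrictMonoOn f A ∧ f '' A = B ∧ ∀ x ∈ A, x ∈ X ↔ f x ∈ Y

namespace Matches

variable {X Y A B : Set ℝ}

theorem neg (h : Matches X Y A B) : Matches (-X) (-Y) (-A) (-B) := by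
  obtain ⟨f, hf, himg, hXY⟩ := h
  refine ⟨fun x => -f (-x), fun x hx y hy hxy => neg_lt_neg (hf hy hx (neg_lt_neg hxy)), ?_,
    fun x hx => by simpa using hXY (-x) hx⟩
  ext y
  rw [mem_neg, ← himg]
  constructor
  · rintro ⟨x, hx, rfl⟩
    exact ⟨-x, hx, by simp⟩
  · rintro ⟨x, hx, hxy⟩
    exact ⟨-x, by simpa using hx, by simp [hxy]⟩

theorem iUnion {ι : Type*} [LinearOrder ι] {A B : ι → Set ℝ}
    (hA : ∀ i j, i < j → setLT (A i) (A j)) (hB : ∀ i j, i < j → setLT (B i) (B j))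
    (h : ∀ i, Matches X Y (A i) (B i)) : Matches X Y (⋃ i, A i) (⋃ i, B i) := by
  classical
  choose f hf himg hXY using h
  let F : ℝ → ℝ := fun x => if hx : ∃ i, x ∈ A i then f hx.choose x else 0
  have huniq : ∀ {i j x}, x ∈ A i → x ∈ A j → i = j := by
    intro i j x hi hj
    rcases lt_trichotomy i j with hij | hij | hij
    · exact absurd (hA i j hij x hi x hj) (lt_irrefl x)
    · exact hij
    · exact absurd (hA j i hij x hj x hi) (lt_irrefl x)
  have hF : ∀ {i x}, x ∈ A i → F x = f i x := by
    intro i x hx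
    have hex : ∃ i, x ∈ A i := ⟨i, hx⟩
    simp only [F, dif_pos hex, huniq hex.choose_spec hx]
  have hFB : ∀ {i x}, x ∈ A i → F x ∈ B i := fun {i x} hx => by
    rw [hF hx, ← himg i]
    exact mem_image_of_mem _ hx
  refine ⟨F, ?_, ?_, ?_⟩
  · intro x hx y hy hxy
    obtain ⟨i, hi⟩ := mem_iUnion.1 hx
    obtain ⟨j, hj⟩ := mem_iUnion.1 hy
    rcases lt_trichotomy i j with hij | rfl | hij
    · exact hB i j hij _ (hFB hi) _ (hFB hj)
    · rw [hF hi, hF hj]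
      exact hf i hi hj hxy
    · exact absurd (hA j i hij y hj x hi) hxy.not_gt
  · rw [image_iUnion]
    exact iUnion_congr fun i => by rw [← himg i]; exact image_congr fun x hx => hF hx
  · intro x hx
    obtain ⟨i, hi⟩ := mem_iUnion.1 hx
    rw [hF hi]
    exact hXY i x hi

theorem union {A' B' : Set ℝ} (h : Matches X Y A B) (h' : Matches X Y A' B')
    (hA : setLT A A') (hB : setLT B B') : Matches X Y (A ∪ A') (B ∪ B') := by
  have key : ∀ {S T : Set ℝ}, setLT S T → ∀ i j : Bool, i < j →
      setLT (cond i T S) (cond j T S) := by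
    intro S T hST i j hij
    cases i <;> cases j <;> first | exact hST | exact absurd hij (by decide)
  have h1 : Matches X Y (⋃ i, cond i A' A) (⋃ i, cond i B' B) :=
    iUnion (key hA) (key hB) (by rintro (_ | _) <;> assumption)
  rwa [← union_eq_iUnion, ← union_eq_iUnion, union_comm, union_comm B'] at h1

theorem Ico_of_Icc {a b c d : ℝ} (hab : a ≤ b) (hcd : c ≤ d)
    (h : Matches X Y (Icc a b) (Icc c d)) : Matches X Y (Ico a b) (Ico c d) := by
  obtain ⟨f, hf, himg, hXY⟩ := h
  refine ⟨f, hf.mono Ico_subset_Icc_self, ?_, fun x hx => hXY x (Ico_subset_Icc_self hx)⟩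
  have hb : b ∈ Icc a b := ⟨hab, le_rfl⟩
  have hfb : f b = d := by
    refine le_antisymm (himg ▸ mem_image_of_mem f hb : f b ∈ Icc c d).2 ?_
    have hd : d ∈ f '' Icc a b := himg ▸ ⟨hcd, le_rfl⟩
    obtain ⟨x, hx, hxd⟩ := hd
    rw [← hxd]
    exact hf.monotoneOn hx hb hx.2
  rw [← Icc_sdiff_right, hf.injOn.image_sdiff_subset (singleton_subset_iff.2 hb), himg,
    image_singleton, hfb, Icc_sdiff_right]

theorem of_forall_notMem (h : Matches univ univ A B) (hA : ∀ x ∈ A, x ∉ X) (hB : ∀ y ∈ B, y ∉ Y) :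
    Matches X Y A B := by
  obtain ⟨f, hf, himg, -⟩ := h
  exact ⟨f, hf, himg, fun x hx => iff_of_false (hA x hx) (hB _ (himg ▸ mem_image_of_mem f hx))⟩

theorem of_subset (h : Matches univ univ A B) (hA : A ⊆ X) (hB : B ⊆ Y) : Matches X Y A B := by
  obtain ⟨f, hf, himg, -⟩ := h
  exact ⟨f, hf, himg, fun x hx => iff_of_true (hA hx) (hB (himg ▸ mem_image_of_mem f hx))⟩

theorem univ_Icc {a b c d : ℝ} (hab : a < b) (hcd : c < d) :
    Matches univ univ (Icc a b) (Icc c d) := by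
  have hab' : 0 < b - a := sub_pos.2 hab
  have hm : 0 < (d - c) / (b - a) := div_pos (sub_pos.2 hcd) hab'
  refine ⟨fun x => (d - c) / (b - a) * x + (c - (d - c) / (b - a) * a),
    fun x _ y _ hxy => by simpa using mul_lt_mul_of_pos_left hxy hm, ?_, by simp⟩
  rw [image_affine_Icc' hm]
  congr 1
  · ring
  · field_simp
    ring

theorem univ_Iio (a c : ℝ) : Matches univ univ (Iio a) (Iio c) :=
  ⟨fun x => x + (c - a), fun x _ y _ hxy => by simpa using hxy, by simp, by simp⟩

theorem univ_Ioi (a c : ℝ) : Matches univ univ (Ioi a) (Ioi c) :=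
  ⟨fun x => x + (c - a), fun x _ y _ hxy => by simpa using hxy, by simp, by simp⟩

end Matches

section Blocks

variable {X Y : Set ℝ} {ρ σ : ℝ → W} {α : W}

/-- The part of `X` between the points `a` and `b` off `X` has one component `[p, q]` of rank `α`,
and all others have smaller rank. -/
structure Block (X : Set ℝ) (ρ : ℝ → W) (α : W) (a b p q : ℝ) : Prop where
  left_notMem : a ∉ X
  right_notMem : b ∉ X
  left_lt : a < p
  lt_right : q < b
  component : RankedComponent X ρ p q
  rank_eq : ρ p = α
  rank_lt : ∀ y ∈ X, y ∈ Icc a b → y ∉ Icc p q → ρ y < α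

theorem Ranked.neg (h : Ranked X ρ) : Ranked (-X) (fun x => ρ (-x)) where
  isCompact := h.isCompact.neg
  exists_component x hx := by
    obtain ⟨p, q, hpq, hc⟩ := h.exists_component (-x) hx
    exact ⟨-q, -p, ⟨by linarith [hpq.2], by linarith [hpq.1]⟩, hc.neg⟩

theorem Block.neg {a b p q : ℝ} (h : Block X ρ α a b p q) :
    Block (-X) (fun x => ρ (-x)) α (-b) (-a) (-q) (-p) where
  left_notMem := by simpa using h.right_notMem
  right_notMem := by simpa using h.left_notMem
  left_lt := neg_lt_neg h.lt_right
  lt_right := neg_lt_neg h.left_lt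
  component := h.component.neg
  rank_eq := by rw [neg_neg, h.component.rank_right, h.rank_eq]
  rank_lt y hy hyI hyn := h.rank_lt (-y) hy ⟨by linarith [hyI.2], by linarith [hyI.1]⟩
    fun hh => hyn ⟨by linarith [hh.2], by linarith [hh.1]⟩

/-- Below a left end point of rank `α`, every `β < α` is the rank of an initial block. -/
theorem Ranked.exists_block (h : Ranked X ρ) {a p q : ℝ} (ha : a ∉ X) (hap : a < p)
    (hc : RankedComponent X ρ p q) {β : W} (hβ : β < ρ p) :
    ∃ b < p, ∃ p' q', Block X ρ β a b p' q' := by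
  let S : Set ℝ := {y | y ∈ X ∧ a < y ∧ y < p ∧ β ≤ ρ y}
  have hSne : S.Nonempty := by
    obtain ⟨y, hy, h1, h2, h3⟩ := hc.left_end.reach β hβ a hap
    exact ⟨y, hy, h1, h2, h3⟩
  have hSbdd : BddBelow S := ⟨a, fun y hy => hy.2.1.le⟩
  set m := sInf S with hm
  have hmX : m ∈ X := closure_minimal (fun y hy => hy.1) h.isCompact.isClosed
    (csInf_mem_closure hSne hSbdd)
  have ham : a < m := lt_of_le_of_ne (le_csInf hSne fun y hy => hy.2.1.le)
    fun hh => ha (hh ▸ hmX)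
  have hmp : m < p := by
    obtain ⟨y, hy⟩ := hSne
    exact (csInf_le hSbdd hy).trans_lt hy.2.2.1
  obtain ⟨l, r, hlr, hc'⟩ := h.exists_component m hmX
  obtain ⟨z, hz, hd⟩ := hc'.drop_right
  have hmr : β ≤ ρ m := by
    obtain ⟨y, hy, hyz⟩ := exists_lt_of_csInf_lt hSne (hlr.2.trans_lt hz)
    have hmy : m ≤ y := csInf_le hSbdd hy
    rw [hc'.const m hlr]
    rcases le_or_gt y r with hyr | hyr
    · rw [← hc'.const y ⟨hlr.1.trans hmy, hyr⟩]
      exact hy.2.2.2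
    · exact hy.2.2.2.trans (hd y hy.1 hyr hyz).le
  have hal : a < l := by
    by_contra! hcon
    exact ha (hc'.subset ⟨hcon, ham.le.trans hlr.2⟩)
  have hml : m = l := by
    refine le_antisymm (csInf_le hSbdd ⟨hc'.left_mem, hal, hlr.1.trans_lt hmp, ?_⟩) hlr.1
    rwa [← hc'.const m hlr]
  rw [hml] at hmr hmp
  have hlβ : ρ l = β := by
    refine le_antisymm ?_ hmr
    by_contra! hcon
    obtain ⟨y, hy, h1, h2, h3⟩ := hc'.left_end.reach β hcon a hal
    exact absurd (csInf_le hSbdd ⟨hy, h1, h2.trans hmp, h3⟩) (by rw [← hm, hml]; exact not_le.2 h2)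
  have hrp : r < p := by
    by_contra! hcon
    have := hc'.const p ⟨hmp.le, hcon⟩
    rw [hlβ] at this
    exact hβ.ne' this
  obtain ⟨b, hb, h1, h2⟩ := hc'.gap_right (min z p) (lt_min hz hrp)
  rw [lt_min_iff] at h2
  refine ⟨b, h2.2, l, r, ha, hb, hal, h1, hc', hlβ, fun y hy hyI hyn => ?_⟩
  have hya : a < y := lt_of_le_of_ne hyI.1 fun hh => ha (hh ▸ hy)
  rcases lt_or_ge y l with hyl | hyl
  · by_contra! hcon
    exact absurd (csInf_le hSbdd ⟨hy, hya, hyl.trans hmp, hcon⟩)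
      (by rw [← hm, hml]; exact not_le.2 hyl)
  · rw [← hlβ]
    exact hd y hy (not_le.1 fun hh => hyn ⟨hyl, hh⟩) (hyI.2.trans_lt h2.1)

/-- The half-open interval `[a, p)` below a left end point decomposes into blocks whose ranks are
prescribed by `β`. -/
theorem Ranked.exists_blocks (h : Ranked X ρ) {a p q : ℝ} (ha : a ∉ X) (hap : a < p)
    (hc : RankedComponent X ρ p q) (hlt : ∀ y ∈ X, a < y → y < p → ρ y < ρ p)
    {β : ℕ → W} (hβ : ∀ n, β n < ρ p) (hcof : ∀ γ < ρ p, ∀ N, ∃ n ≥ N, γ ≤ β n) :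
    ∃ s : ℕ → ℝ, StrictMono s ∧ (⋃ n, Ico (s n) (s (n + 1))) = Ico a p ∧
      ∀ n, ∃ p' q', Block X ρ (β n) (s n) (s (n + 1)) p' q' := by
  have step : ∀ (n : ℕ) (t : {t : ℝ // t ∉ X ∧ t < p}), ∃ t' : {t : ℝ // t ∉ X ∧ t < p},
      ∃ p' q', Block X ρ (β n) t t' p' q' := by
    rintro n ⟨t, ht, htp⟩
    obtain ⟨b, hbp, p', q', hB⟩ := h.exists_block ht htp hc (hβ n)
    exact ⟨⟨b, hB.right_notMem, hbp⟩, p', q', hB⟩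
  choose next hnext using step
  let S : ℕ → {t : ℝ // t ∉ X ∧ t < p} := fun n => Nat.rec ⟨a, ha, hap⟩ next n
  let s : ℕ → ℝ := fun n => (S n).1
  have hblock : ∀ n, ∃ p' q', Block X ρ (β n) (s n) (s (n + 1)) p' q' := fun n => hnext n (S n)
  have hs : StrictMono s := strictMono_nat_of_lt_succ fun n => by
    obtain ⟨p', q', hB⟩ := hblock n
    exact hB.left_lt.trans (hB.component.lt.trans hB.lt_right)
  have hsp : ∀ n, s n < p := fun n => (S n).2.2
  have hsX : ∀ n, s n ∉ X := fun n => (S n).2.1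
  have hlim : ∀ x < p, ∃ n, x < s n := by
    intro x hx
    by_contra! hcon
    have hbdd : BddAbove (range s) := ⟨x, forall_mem_range.2 hcon⟩
    set t := ⨆ n, s n with ht
    have htend : Filter.Tendsto s Filter.atTop (𝓝 t) := tendsto_atTop_ciSup hs.monotone hbdd
    have hst : ∀ n, s n < t := fun n =>
      (hs (Nat.lt_succ_self n)).trans_le (le_ciSup hbdd (n + 1))
    have htp : t < p := (ciSup_le hcon).trans_lt hx
    choose P Q hB using hblock
    have hPlim : Filter.Tendsto P Filter.atTop (𝓝 t) :=
      tendsto_of_tendsto_of_tendsto_of_le_of_le htend (htend.comp (Filter.tendsto_add_atTop_nat 1))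
        (fun n => (hB n).left_lt.le)
        (fun n => ((hB n).component.lt.trans (hB n).lt_right).le)
    have htX : t ∈ X := h.isCompact.isClosed.mem_of_tendsto hPlim
      (Filter.Eventually.of_forall fun n => (hB n).component.left_mem)
    have hat : a < t := hst 0
    obtain ⟨l, r, hlr, hc'⟩ := h.exists_component t htX
    have hlt' : t = l := by
      refine le_antisymm ?_ hlr.1
      by_contra! hcon'
      obtain ⟨n, hn⟩ := (htend.eventually (lt_mem_nhds hcon')).exists
      exact hsX n (hc'.subset ⟨hn.le, (hst n).le.trans hlr.2⟩)
    obtain ⟨z, hz, hd⟩ := hc'.left_end.drop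
    rw [← hlt'] at hz
    obtain ⟨N, hN⟩ := Filter.eventually_atTop.1 (htend.eventually (lt_mem_nhds hz))
    obtain ⟨n, hn, hγ⟩ := hcof (ρ t) (hlt t htX hat htp) N
    have h1 := hd (P n) (hB n).component.left_mem ((hN n hn).trans (hB n).left_lt)
      (hlt' ▸ ((hB n).component.lt.trans (hB n).lt_right).trans (hst (n + 1)))
    rw [(hB n).rank_eq, ← hlt'] at h1
    exact absurd hγ (not_le.2 h1)
  refine ⟨s, hs, ?_, hblock⟩
  ext x
  simp only [mem_iUnion, mem_Ico]
  constructor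
  · rintro ⟨n, h1, h2⟩
    exact ⟨(hs.monotone (Nat.zero_le n)).trans h1, h2.trans (hsp (n + 1))⟩
  · rintro ⟨h1, h2⟩
    have hex := hlim x h2
    classical
    have hspec := Nat.find_spec hex
    have hpos : Nat.find hex ≠ 0 := fun h0 => by
      rw [h0] at hspec
      exact absurd h1 (not_le.2 hspec)
    obtain ⟨k, hk⟩ := Nat.exists_eq_succ_of_ne_zero hpos
    refine ⟨k, not_lt.1 (Nat.find_min hex (by omega)), ?_⟩
    rw [hk] at hspec
    exact hspec

theorem exists_seq_cofinal {α : W} (hcount : (Iio α).Countable) (hne : (Iio α).Nonempty) :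
    ∃ β : ℕ → W, (∀ n, β n < α) ∧ ∀ γ < α, ∀ N, ∃ n ≥ N, γ ≤ β n := by
  obtain ⟨f, hf⟩ := hcount.exists_eq_range hne
  refine ⟨fun n => f n.unpair.1, fun n => ?_, fun γ hγ N => ?_⟩
  · have : f n.unpair.1 ∈ Iio α := hf ▸ mem_range_self _
    exact this
  · have : γ ∈ range f := hf ▸ hγ
    obtain ⟨k, rfl⟩ := this
    exact ⟨Nat.pair k N, Nat.right_le_pair k N, by simp⟩

theorem setLT_Ico {s : ℕ → ℝ} (hs : StrictMono s) (i j : ℕ) (hij : i < j) :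
    setLT (Ico (s i) (s (i + 1))) (Ico (s j) (s (j + 1))) :=
  fun _ hx _ hy => hx.2.trans_le ((hs.monotone hij).trans hy.1)

theorem Block.matches_left (hρ : Ranked X ρ) (hσ : Ranked Y σ) (hcount : (Iio α).Countable)
    (ih : ∀ β < α, ∀ {a b p q c d p' q' : ℝ}, Block X ρ β a b p q → Block Y σ β c d p' q' →
      Matches X Y (Icc a b) (Icc c d))
    {a b p q c d p' q' : ℝ} (hB : Block X ρ α a b p q) (hB' : Block Y σ α c d p' q') :
    Matches X Y (Ico a p) (Ico c p') := by
  have hlt : ∀ {X : Set ℝ} {ρ : ℝ → W} {a b p q : ℝ}, Block X ρ α a b p q →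
      ∀ y ∈ X, a ≤ y → y < p → ρ y < ρ p := by
    intro X ρ a b p q hB y hy h1 h2
    rw [hB.rank_eq]
    exact hB.rank_lt y hy ⟨h1, (h2.trans (hB.component.lt.trans hB.lt_right)).le⟩
      fun hh => absurd hh.1 (not_le.2 h2)
  rcases (Iio α).eq_empty_or_nonempty with hemp | hne
  · have hno : ∀ {X : Set ℝ} {ρ : ℝ → W} {a b p q : ℝ}, Block X ρ α a b p q →
        ∀ y ∈ Ico a p, y ∉ X := by
      intro X ρ a b p q hB y hy hyX
      have h1 : ρ y ∈ Iio α := hB.rank_eq ▸ hlt hB y hyX hy.1 hy.2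
      rw [hemp] at h1
      exact h1
    exact ((Matches.univ_Icc hB.left_lt hB'.left_lt).Ico_of_Icc hB.left_lt.le
      hB'.left_lt.le).of_forall_notMem (hno hB) (hno hB')
  · obtain ⟨β, hβ, hcof⟩ := exists_seq_cofinal hcount hne
    obtain ⟨s, hs, hsU, hsB⟩ := hρ.exists_blocks hB.left_notMem hB.left_lt hB.component
      (fun y hy h1 h2 => hlt hB y hy h1.le h2) (hB.rank_eq ▸ hβ) (hB.rank_eq ▸ hcof)
    obtain ⟨t, ht, htU, htB⟩ := hσ.exists_blocks hB'.left_notMem hB'.left_lt hB'.component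
      (fun y hy h1 h2 => hlt hB' y hy h1.le h2) (hB'.rank_eq ▸ hβ) (hB'.rank_eq ▸ hcof)
    rw [← hsU, ← htU]
    refine Matches.iUnion (setLT_Ico hs) (setLT_Ico ht) fun n => ?_
    obtain ⟨_, _, h1⟩ := hsB n
    obtain ⟨_, _, h2⟩ := htB n
    exact (ih _ (hβ n) h1 h2).Ico_of_Icc (hs n.lt_succ_self).le (ht n.lt_succ_self).le

/-- Blocks of equal rank are equivalent under increasing bijections. -/
theorem Block.matches [WellFoundedLT W] (hcount : ∀ α : W, (Iio α).Countable)
    (hρ : Ranked X ρ) (hσ : Ranked Y σ)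
    {a b p q c d p' q' : ℝ} (hB : Block X ρ α a b p q) (hB' : Block Y σ α c d p' q') :
    Matches X Y (Icc a b) (Icc c d) := by
  induction α using WellFoundedLT.induction generalizing X Y ρ σ a b p q c d p' q' with
  | ind α ih =>
    have hleft := hB.matches_left hρ hσ (hcount α)
      (fun β hβ _ _ _ _ _ _ _ _ h1 h2 => ih β hβ hρ hσ h1 h2) hB'
    have hright := (hB.neg.matches_left hρ.neg hσ.neg (hcount α)
      (fun β hβ _ _ _ _ _ _ _ _ h1 h2 => ih β hβ hρ.neg hσ.neg h1 h2) hB'.neg).neg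
    simp only [neg_neg, Set.neg_Ico] at hright
    have hmid : Matches X Y (Icc p q) (Icc p' q') :=
      (Matches.univ_Icc hB.component.lt hB'.component.lt).of_subset hB.component.subset
        hB'.component.subset
    have key : ∀ {X : Set ℝ} {ρ : ℝ → W} {a b p q : ℝ}, Block X ρ α a b p q →
        setLT (Ico a p) (Icc p q) ∧ setLT (Ico a p ∪ Icc p q) (Ioc q b) ∧
          Ico a p ∪ Icc p q ∪ Ioc q b = Icc a b := by
      intro X ρ a b p q hB
      refine ⟨fun x hx y hy => hx.2.trans_le hy.1, ?_, ?_⟩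
      · rintro x (hx | hx) y hy
        · exact hx.2.trans (hB.component.lt.trans hy.1)
        · exact hx.2.trans_lt hy.1
      · rw [Ico_union_Icc_eq_Icc hB.left_lt.le hB.component.lt.le, Icc_union_Ioc_eq_Icc
          (hB.left_lt.trans hB.component.lt).le hB.lt_right.le]
    obtain ⟨h1, h2, h3⟩ := key hB
    obtain ⟨h1', h2', h3'⟩ := key hB'
    rw [← h3, ← h3']
    exact (hleft.union hmid h1 h1').union hright h2 h2'

theorem HasRank.isTame [WellFoundedLT W] (hcount : ∀ α : W, (Iio α).Countable)
    (hX : HasRank X α) : IsTame X := by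
  rintro Y ⟨e⟩
  have hY := hX.of_homeomorph e
  have bound : ∀ {X : Set ℝ}, HasRank X α → ∃ (ρ : ℝ → W) (a b p q : ℝ), Ranked X ρ ∧ a ≤ b ∧
      X ⊆ Icc a b ∧ Block X ρ α a b p q := by
    rintro X ⟨ρ, hρ, p, q, ht⟩
    obtain ⟨a, ha⟩ := hρ.isCompact.bddBelow
    obtain ⟨b, hb⟩ := hρ.isCompact.bddAbove
    have hap := ha ht.component.left_mem
    have hqb := hb ht.component.right_mem
    have := ht.component.lt
    refine ⟨ρ, a - 1, b + 1, p, q, hρ, by linarith,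
      fun x hx => ⟨by linarith [ha hx], by linarith [hb hx]⟩, ⟨fun h => by linarith [ha h],
        fun h => by linarith [hb h], by linarith, by linarith, ht.component, ht.rank_eq,
        fun y hy _ hyn => ht.rank_lt y hy hyn⟩⟩
  obtain ⟨ρ, a, b, p, q, hρ, hab, hXab, hB⟩ := bound hX
  obtain ⟨σ, c, d, p', q', hσ, hcd, hYcd, hB'⟩ := bound hY
  have hmid := hB.matches hcount hρ hσ hB'
  have hlow := (Matches.univ_Iio a c).of_forall_notMem (X := X) (Y := Y)
    (fun x hx h => absurd (hXab h).1 (not_le.2 hx)) (fun x hx h => absurd (hYcd h).1 (not_le.2 hx))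
  have hhigh := (Matches.univ_Ioi b d).of_forall_notMem (X := X) (Y := Y)
    (fun x hx h => absurd (hXab h).2 (not_le.2 hx)) (fun x hx h => absurd (hYcd h).2 (not_le.2 hx))
  have key : ∀ {a b : ℝ}, a ≤ b → setLT (Iio a) (Icc a b) ∧ setLT (Iio a ∪ Icc a b) (Ioi b) ∧
      Iio a ∪ Icc a b ∪ Ioi b = univ := by
    intro a b hab
    refine ⟨fun x hx y hy => lt_of_lt_of_le hx hy.1, ?_, ?_⟩
    · rintro x (hx | hx) y hy
      · exact (lt_of_lt_of_le hx hab).trans hy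
      · exact hx.2.trans_lt hy
    · rw [Iio_union_Icc_eq_Iic hab, Iic_union_Ioi]
  obtain ⟨h1, h2, h3⟩ := key hab
  obtain ⟨h1', h2', h3'⟩ := key hcd
  have hall := (hlow.union hmid h1 h1').union hhigh h2 h2'
  rw [h3, h3'] at hall
  obtain ⟨f, hf, himg, hXY⟩ := hall
  rw [image_univ] at himg
  refine ⟨(StrictMono.orderIsoOfSurjective f (strictMonoOn_univ.1 hf)
    (range_eq_univ.1 himg)).toHomeomorph, ?_⟩
  ext y
  constructor
  · rintro ⟨x, hx, rfl⟩
    exact (hXY x (mem_univ x)).1 hx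
  · intro hy
    obtain ⟨x, rfl⟩ := range_eq_univ.1 himg y
    exact ⟨x, (hXY x (mem_univ x)).2 hy, rfl⟩

end Blocks

section Construction

/-- A central interval together with a null sequence of ranked sets accumulating at its ends. -/
structure Cluster {J : Type*} (α : W) (p q : ℝ) (u v : J → ℝ) (X : J → Set ℝ) (ρ : J → ℝ → W)
    (β : J → W) : Prop where
  lt : p < q
  subset : ∀ j, X j ⊆ Ioo (u j) (v j)
  ranked : ∀ j, Ranked (X j) (ρ j)
  rank_le : ∀ j, ∀ x ∈ X j, ρ j x ≤ β j
  exists_rank_eq : ∀ j, ∃ x ∈ X j, ρ j x = β j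
  lt_rank : ∀ j, β j < α
  separated : ∀ i j, i ≠ j → v i ≤ u j ∨ v j ≤ u i
  off_center : ∀ j, v j < p ∨ q < u j
  finite : ∀ z < p, ∀ w > q, {j | ¬Ioo (u j) (v j) ⊆ Ioo z w}.Finite
  reach_left : ∀ γ < α, ∀ z < p, ∃ j, γ ≤ β j ∧ z < u j ∧ v j < p
  reach_right : ∀ γ < α, ∀ z > q, ∃ j, γ ≤ β j ∧ q < u j ∧ v j < z

namespace Cluster

variable {J : Type*} {α : W} {p q : ℝ} {u v : J → ℝ} {X : J → Set ℝ} {ρ : J → ℝ → W} {β : J → W}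

theorem fst_lt_snd (h : Cluster α p q u v X ρ β) (j : J) : u j < v j := by
  obtain ⟨x, hx, -⟩ := h.exists_rank_eq j
  exact (h.subset j hx).1.trans (h.subset j hx).2

theorem eq_of_mem (h : Cluster α p q u v X ρ β) {i j : J} {x : ℝ} (hi : x ∈ Ioo (u i) (v i))
    (hj : x ∈ Ioo (u j) (v j)) : i = j := by
  by_contra hij
  rcases h.separated i j hij with h1 | h1
  · linarith [hi.2, hj.1]
  · linarith [hi.1, hj.2]

theorem notMem_Icc (h : Cluster α p q u v X ρ β) {j : J} {x : ℝ} (hx : x ∈ Icc (u j) (v j)) :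
    x ∉ Icc p q := by
  intro hpq
  rcases h.off_center j with h1 | h1
  · linarith [hx.2, hpq.1]
  · linarith [hx.1, hpq.2]

theorem snd_notMem (h : Cluster α p q u v X ρ β) (j : J) : v j ∉ Icc p q ∪ ⋃ j, X j := by
  have hlt := h.fst_lt_snd j
  rintro (hv | hv)
  · exact h.notMem_Icc ⟨hlt.le, le_rfl⟩ hv
  · obtain ⟨k, hk⟩ := mem_iUnion.1 hv
    have hk' := h.subset k hk
    by_cases hjk : j = k
    · subst hjk
      exact lt_irrefl _ hk'.2
    · rcases h.separated j k hjk with h1 | h1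
      · linarith [hk'.1]
      · linarith [hk'.2]

theorem fst_notMem (h : Cluster α p q u v X ρ β) (j : J) : u j ∉ Icc p q ∪ ⋃ j, X j := by
  have hlt := h.fst_lt_snd j
  rintro (hv | hv)
  · exact h.notMem_Icc ⟨le_rfl, hlt.le⟩ hv
  · obtain ⟨k, hk⟩ := mem_iUnion.1 hv
    have hk' := h.subset k hk
    by_cases hjk : j = k
    · subst hjk
      exact lt_irrefl _ hk'.1
    · rcases h.separated j k hjk with h1 | h1
      · linarith [hk'.1]
      · linarith [hk'.2]

theorem isCompact (h : Cluster α p q u v X ρ β) : IsCompact (Icc p q ∪ ⋃ j, X j) := by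
  have hsub : ∀ z < p, ∀ w > q, ∃ K ⊆ ⋃ j, X j, IsCompact K ∧
      closure (Icc p q ∪ ⋃ j, X j) ⊆ Icc z w ∪ K := by
    intro z hz w hw
    have hK : IsCompact (⋃ j ∈ {j | ¬Ioo (u j) (v j) ⊆ Ioo z w}, X j) :=
      (h.finite z hz w hw).isCompact_biUnion fun j _ => (h.ranked j).isCompact
    refine ⟨_, iUnion₂_subset fun j _ => subset_iUnion X j, hK, closure_minimal ?_
      (isClosed_Icc.union hK.isClosed)⟩
    rintro x (hx | hx)
    · exact Or.inl ⟨hz.le.trans hx.1, hx.2.trans hw.le⟩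
    · obtain ⟨j, hj⟩ := mem_iUnion.1 hx
      by_cases hjs : Ioo (u j) (v j) ⊆ Ioo z w
      · exact Or.inl (Ioo_subset_Icc_self (hjs (h.subset j hj)))
      · exact Or.inr (mem_biUnion (show j ∈ {j | ¬Ioo (u j) (v j) ⊆ Ioo z w} from hjs) hj)
  have hclosed : IsClosed (Icc p q ∪ ⋃ j, X j) := by
    refine isClosed_of_closure_subset fun y hy => ?_
    rcases lt_or_ge y p with hyp | hyp
    · obtain ⟨z, hyz, hzp⟩ := exists_between hyp
      obtain ⟨K, hKs, -, hK⟩ := hsub z hzp (q + 1) (by linarith)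
      rcases hK hy with h1 | h1
      · linarith [h1.1]
      · exact Or.inr (hKs h1)
    · rcases le_or_gt y q with hyq | hyq
      · exact Or.inl ⟨hyp, hyq⟩
      · obtain ⟨w, hqw, hwy⟩ := exists_between hyq
        obtain ⟨K, hKs, -, hK⟩ := hsub (p - 1) (by linarith) w hqw
        rcases hK hy with h1 | h1
        · linarith [h1.2]
        · exact Or.inr (hKs h1)
  obtain ⟨K, -, hKc, hK⟩ := hsub (p - 1) (by linarith) (q + 1) (by linarith)
  exact (isCompact_Icc.union hKc).of_isClosed_subset hclosed (subset_closure.trans hK)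

theorem exists_rank (h : Cluster α p q u v X ρ β) :
    ∃ R : ℝ → W, Ranked (Icc p q ∪ ⋃ j, X j) R ∧ HasTop (Icc p q ∪ ⋃ j, X j) R α p q := by
  classical
  let R : ℝ → W := fun x => if hx : ∃ j, x ∈ X j then ρ hx.choose x else α
  have hR : ∀ {j x}, x ∈ X j → R x = ρ j x := by
    intro j x hx
    have hex : ∃ j, x ∈ X j := ⟨j, hx⟩
    have : hex.choose = j := h.eq_of_mem (h.subset _ hex.choose_spec) (h.subset j hx)
    simp only [R, dif_pos hex, this]
  have hRc : ∀ x ∈ Icc p q, R x = α := by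
    intro x hx
    refine dif_neg ?_
    rintro ⟨j, hj⟩
    exact h.notMem_Icc (Ioo_subset_Icc_self (h.subset j hj)) hx
  have hRlt : ∀ {j x}, x ∈ X j → R x < α := fun {j x} hx => by
    rw [hR hx]
    exact (h.rank_le j x hx).trans_lt (h.lt_rank j)
  have hp := hRc p ⟨le_rfl, h.lt.le⟩
  have hq := hRc q ⟨h.lt.le, le_rfl⟩
  have hcenter : RankedComponent (Icc p q ∪ ⋃ j, X j) R p q := by
    refine ⟨h.lt, subset_union_left, fun x hx => by rw [hRc x hx, hp], ⟨?_, ?_, ?_⟩, ?_, ?_, ?_⟩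
    · intro z hz
      by_contra! hcon
      obtain ⟨y, hzy, hyp⟩ := exists_between hz
      have hy : y ∈ Icc p q ∪ ⋃ j, X j := by
        by_contra hy
        exact absurd (hcon y hy hzy) (not_le.2 hyp)
      rcases hy with hy | hy
      · linarith [hy.1]
      · obtain ⟨j, hj⟩ := mem_iUnion.1 hy
        have hj' := h.subset j hj
        have := hcon (v j) (h.snd_notMem j) (hzy.trans hj'.2)
        rcases h.off_center j with h1 | h1
        · linarith
        · linarith [hj'.1, h.lt]
    · refine ⟨p - 1, by linarith, fun y hy _ hyp => ?_⟩
      rw [hp]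
      rcases hy with hy | hy
      · linarith [hy.1]
      · obtain ⟨j, hj⟩ := mem_iUnion.1 hy
        exact hRlt hj
    · intro γ hγ z hz
      rw [hp] at hγ
      obtain ⟨j, h1, h2, h3⟩ := h.reach_left γ hγ z hz
      obtain ⟨x, hx, hxr⟩ := h.exists_rank_eq j
      have hx' := h.subset j hx
      exact ⟨x, Or.inr (mem_iUnion.2 ⟨j, hx⟩), h2.trans hx'.1, hx'.2.trans h3,
        by rwa [hR hx, hxr]⟩
    · intro z hz
      by_contra! hcon
      obtain ⟨y, hzy, hyp⟩ := exists_between hz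
      have hy : -y ∈ Icc p q ∪ ⋃ j, X j := by
        by_contra hy
        exact absurd (hcon y hy hzy) (not_le.2 hyp)
      rcases hy with hy | hy
      · linarith [hy.2]
      · obtain ⟨j, hj⟩ := mem_iUnion.1 hy
        have hj' := h.subset j hj
        have := hcon (-u j) (by rw [mem_neg, neg_neg]; exact h.fst_notMem j) (by linarith [hj'.1])
        rcases h.off_center j with h1 | h1
        · linarith [hj'.2, h.lt]
        · linarith
    · refine ⟨-q - 1, by linarith, fun y hy _ hyp => ?_⟩
      simp only [neg_neg, hq]
      rcases hy with hy | hy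
      · linarith [hy.2]
      · obtain ⟨j, hj⟩ := mem_iUnion.1 hy
        exact hRlt hj
    · intro γ hγ z hz
      simp only [neg_neg, hq] at hγ
      obtain ⟨j, h1, h2, h3⟩ := h.reach_right γ hγ (-z) (by linarith)
      obtain ⟨x, hx, hxr⟩ := h.exists_rank_eq j
      have hx' := h.subset j hx
      refine ⟨-x, ?_, by linarith [hx'.2], by linarith [hx'.1], by rwa [neg_neg, hR hx, hxr]⟩
      rw [mem_neg, neg_neg]
      exact Or.inr (mem_iUnion.2 ⟨j, hx⟩)
  refine ⟨R, ⟨h.isCompact, ?_⟩, hcenter, hp, ?_⟩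
  · rintro x (hx | hx)
    · exact ⟨p, q, hx, hcenter⟩
    · obtain ⟨j, hj⟩ := mem_iUnion.1 hx
      obtain ⟨a, b, hab, hc⟩ := (h.ranked j).exists_component x hj
      refine ⟨a, b, hab, hc.congr (hc.subset.trans (h.subset j)) (fun y hy => ?_)
        fun y hy _ => hR hy⟩
      refine ⟨?_, fun hyj => Or.inr (mem_iUnion.2 ⟨j, hyj⟩)⟩
      rintro (hy' | hy')
      · exact absurd hy' (h.notMem_Icc (Ioo_subset_Icc_self hy))
      · obtain ⟨k, hk⟩ := mem_iUnion.1 hy'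
        rwa [h.eq_of_mem hy (h.subset k hk)]
  · rintro y (hy | hy) hyn
    · exact absurd hy hyn
    · obtain ⟨j, hj⟩ := mem_iUnion.1 hy
      exact hRlt hj

end Cluster

theorem exists_ranked [WellFoundedLT W] (hcount : ∀ α : W, (Iio α).Countable) (α : W) (a b : ℝ)
    (hab : a < b) :
    ∃ (X : Set ℝ) (ρ : ℝ → W) (p q : ℝ), X ⊆ Ioo a b ∧ Ranked X ρ ∧ HasTop X ρ α p q := by
  induction α using WellFoundedLT.induction generalizing a b with
  | ind α ih =>
    have : Countable (Iio α) := (hcount α).to_subtype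
    obtain ⟨e, he⟩ := Countable.exists_injective_nat (Iio α × ℕ)
    obtain ⟨p, hap, hpb⟩ := exists_between hab
    obtain ⟨q, hpq, hqb⟩ := exists_between hpb
    obtain ⟨δ, hδ, hδm⟩ := exists_between (lt_min (sub_pos.2 hap) (sub_pos.2 hqb))
    obtain ⟨hδa, hδb⟩ := lt_min_iff.1 hδm
    let s : ℕ → ℝ := fun n => δ / (n + 1)
    have hs : StrictAnti s := fun m n hmn => by
      have : (m : ℝ) < n := Nat.cast_lt.2 hmn
      exact div_lt_div_of_pos_left hδ (by positivity) (by linarith)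
    have hs0 : ∀ n, 0 < s n := fun n => by positivity
    have hsδ : ∀ n, s n ≤ δ := fun n => (hs.antitone (Nat.zero_le n)).trans_eq (by simp [s])
    have hlim : ∀ ε > 0, ∃ N, ∀ n ≥ N, s n < ε := fun ε hε => by
      have h1 : Filter.Tendsto s Filter.atTop (𝓝 0) := by
        simpa [s, div_eq_mul_inv] using
          (tendsto_one_div_add_atTop_nhds_zero_nat (𝕜 := ℝ)).const_mul δ
      exact Filter.eventually_atTop.1 (h1.eventually (gt_mem_nhds hε))
    let u : Bool × (Iio α × ℕ) → ℝ := fun j => cond j.1 (q + s (e j.2 + 1)) (p - s (e j.2))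
    let v : Bool × (Iio α × ℕ) → ℝ := fun j => cond j.1 (q + s (e j.2)) (p - s (e j.2 + 1))
    have huv : ∀ j, u j < v j := by
      rintro ⟨_ | _, k⟩ <;> simp only [u, v, cond] <;> linarith [hs (e k).lt_succ_self]
    choose X ρ P Q hsub hrk htop using fun j : Bool × (Iio α × ℕ) =>
      ih j.2.1 j.2.1.2 (u j) (v j) (huv j)
    have hfar : ∀ γ < α, ∀ N, ∃ k, N ≤ e (k : Iio α × ℕ) ∧ γ ≤ k.1 := by
      intro γ hγ N
      have hinj : Function.Injective fun m : ℕ => e (⟨γ, hγ⟩, m) := fun m n hmn => by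
        simpa using he hmn
      by_contra! hcon
      refine infinite_univ.mono (fun m _ => ?_) ((finite_Iio N).preimage hinj.injOn)
      by_contra hm
      exact absurd (hcon (⟨γ, hγ⟩, m) (not_lt.1 hm)) (lt_irrefl γ)
    have hC : Cluster α p q u v X ρ (fun j => j.2.1) := by
      refine ⟨hpq, hsub, hrk, fun j x hx => ?_, fun j => ?_, fun j => j.2.1.2, ?_, ?_, ?_, ?_, ?_⟩
      · by_cases hxP : x ∈ Icc (P j) (Q j)
        · rw [(htop j).component.const x hxP, (htop j).rank_eq]
        · exact ((htop j).rank_lt x hx hxP).le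
      · exact ⟨P j, (htop j).component.left_mem, (htop j).rank_eq⟩
      · rintro ⟨b₁, k₁⟩ ⟨b₂, k₂⟩ hne
        by_cases hb : b₁ = b₂
        · subst hb
          have hk : e k₁ ≠ e k₂ := fun hh => hne (by rw [he hh])
          have key : s (e k₁) ≤ s (e k₂ + 1) ∨ s (e k₂) ≤ s (e k₁ + 1) := by
            rcases lt_or_gt_of_ne hk with h1 | h1
            · exact Or.inr (hs.antitone h1)
            · exact Or.inl (hs.antitone h1)
          cases b₁ <;> simp only [u, v, cond] <;> rcases key with h1 | h1
          · exact Or.inr (by linarith)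
          · exact Or.inl (by linarith)
          · exact Or.inl (by linarith)
          · exact Or.inr (by linarith)
        · have h1 := hs0 (e k₁ + 1)
          have h2 := hs0 (e k₂ + 1)
          cases b₁ <;> cases b₂ <;> simp only [u, v, cond]
          · exact absurd rfl hb
          · exact Or.inl (by linarith)
          · exact Or.inr (by linarith)
          · exact absurd rfl hb
      · rintro ⟨_ | _, k⟩ <;> simp only [u, v, cond]
        · exact Or.inl (by linarith [hs0 (e k + 1)])
        · exact Or.inr (by linarith [hs0 (e k + 1)])
      · intro z hz w hw
        obtain ⟨N, hN⟩ := hlim (min (p - z) (w - q)) (lt_min (by linarith) (by linarith))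
        have hinj : Function.Injective fun j : Bool × (Iio α × ℕ) => (j.1, e j.2) :=
          Function.injective_id.prodMap he
        refine (((finite_univ (α := Bool)).prod (finite_Iio N)).preimage hinj.injOn).subset ?_
        rintro ⟨b₁, k⟩ hj
        refine ⟨mem_univ _, ?_⟩
        by_contra hk
        have h1 := lt_min_iff.1 (hN (e k) (not_lt.1 hk))
        have h2 := hs0 (e k + 1)
        refine hj (Ioo_subset_Ioo ?_ ?_) <;> cases b₁ <;> simp only [u, v, cond] <;> linarith
      · intro γ hγ z hz
        obtain ⟨N, hN⟩ := hlim (p - z) (by linarith)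
        obtain ⟨k, hk, hγk⟩ := hfar γ hγ N
        refine ⟨(false, k), hγk, ?_, ?_⟩ <;> simp only [u, v, cond]
        · linarith [hN _ hk]
        · linarith [hs0 (e k + 1)]
      · intro γ hγ z hz
        obtain ⟨N, hN⟩ := hlim (z - q) (by linarith)
        obtain ⟨k, hk, hγk⟩ := hfar γ hγ N
        refine ⟨(true, k), hγk, ?_, ?_⟩ <;> simp only [u, v, cond]
        · linarith [hs0 (e k + 1)]
        · linarith [hN _ hk]
    obtain ⟨R, hR, hT⟩ := hC.exists_rank
    refine ⟨_, R, p, q, ?_, hR, hT⟩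
    refine union_subset (fun x hx => ⟨hap.trans_le hx.1, hx.2.trans_lt hqb⟩)
      (iUnion_subset fun j => (hsub j).trans (Ioo_subset_Ioo ?_ ?_))
    · obtain ⟨_ | _, k⟩ := j <;> simp only [u, cond]
      · linarith [hsδ (e k)]
      · linarith [hs0 (e k + 1)]
    · obtain ⟨_ | _, k⟩ := j <;> simp only [v, cond]
      · linarith [hs0 (e k + 1)]
      · linarith [hsδ (e k)]

end Construction

theorem Ranked.regularlyClosedIn {X : Set ℝ} {ρ : ℝ → W} (h : Ranked X ρ) :
    RegularlyClosedIn X := by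
  refine ⟨h.isCompact.isClosed, fun x hx => subset_closure ?_⟩
  obtain ⟨p, q, hpq, hc⟩ := h.exists_component x hx
  refine ⟨connectedComponentIn X x, ⟨⟨x, hx, rfl⟩, ?_⟩, mem_connectedComponentIn hx⟩
  have hsub := isPreconnected_Icc.subset_connectedComponentIn hpq hc.subset
  exact ⟨p, hsub ⟨le_rfl, hc.lt.le⟩, q, hsub ⟨hc.lt.le, le_rfl⟩, hc.lt.ne⟩

theorem countable_Iio_toType_omega_one (i : (Ordinal.omega 1).ToType) : (Iio i).Countable := by
  rw [← Cardinal.le_aleph0_iff_set_countable, ← Cardinal.lt_aleph_one_iff]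
  simpa using Cardinal.mk_Iio_lt i (by simp)

end RankedSets

theorem exists_aleph_one_nonhomeomorphic_tame_sets :
    ∃ S : Set (Set ℝ), Cardinal.aleph 1 ≤ Cardinal.mk S ∧
      (∀ X ∈ S, IsCompact X ∧ RegularlyClosedIn X ∧ IsTame X) ∧
      S.Pairwise (fun X Y => IsEmpty (↥X ≃ₜ ↥Y)) := by
  have hcount := countable_Iio_toType_omega_one
  choose X hX using fun i : (Ordinal.omega 1).ToType =>
    (show ∃ X : Set ℝ, HasRank X i by
      obtain ⟨X, ρ, p, q, -, hρ, ht⟩ := exists_ranked hcount i 0 1 one_pos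
      exact ⟨X, ρ, hρ, p, q, ht⟩)
  have hinj : Function.Injective X := fun i j hij => (hX i).unique (hij ▸ hX j)
  refine ⟨range X, ?_, ?_, ?_⟩
  · rw [Cardinal.mk_range_eq X hinj, Cardinal.mk_toType, Ordinal.card_omega]
  · rintro _ ⟨i, rfl⟩
    obtain ⟨ρ, hρ, -⟩ := hX i
    exact ⟨hρ.isCompact, hρ.regularlyClosedIn, (hX i).isTame hcount⟩
  · rintro _ ⟨i, rfl⟩ _ ⟨j, rfl⟩ hne
    exact ⟨fun e => hne (congrArg X (((hX i).of_homeomorph e).unique (hX j)))⟩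
end
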